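/- arXiv:2110.14047 — 7 statements merged into one kernel-verified Lean document; each statement's English description precedes it below -/
import Mathlib

section
/- Fundamental Liouville identity along a single trajectory: let T > 0, let f : ℝ × ℝⁿ → ℝⁿ be continuous, let x : [0,T] → ℝⁿ be differentiable with x'(t) = f(t, x(t)) for all t ∈ [0,T], and let t_p ∈ [0,T]. Then for every continuously differentiable function v : ℝ × ℝⁿ → ℝ one has v(t_p, x(t_p)) = v(0, x(0)) + ∫₀^{t_p} [∂_t v(t, x(t)) + f(t, x(t)) · ∇_x v(t, x(t))] dt. Consequently, the Dirac measure δ_{x(0)}, the Dirac measure δ_{(t_p, x(t_p))}, and the occupation measure of the curve t ↦ (t, x(t)) on [0, t_p] (the pushforward of Lebesgue measure on [0, t_p] under this map) satisfy Liouville's equation: ∫ v dμ_p = ∫ v(0, x) dμ₀ + ∫ L_f v dμ for all C¹ test functions v. -/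
open MeasureTheory Set

noncomputable section

/-- `ℝⁿ` -/
abbrev Vec (n : ℕ) : Type := EuclideanSpace ℝ (Fin n)

/-- Lie derivative of `v` along the vector field `f`:
`L_f v (t,x) = ∂_t v (t,x) + f (t,x) ⬝ ∇ₓ v (t,x)`, expressed as the Fréchet
derivative of `v` at `(t,x)` in the direction `(1, f (t,x))`. -/
def LieD {n : ℕ} (f : ℝ × Vec n → Vec n) (v : ℝ × Vec n → ℝ) (p : ℝ × Vec n) : ℝ :=
  fderiv ℝ v p ((1 : ℝ), f p)

theorem continuous_lieD {n : ℕ} {f : ℝ × Vec n → Vec n} (hf : Continuous f)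
    {v : ℝ × Vec n → ℝ} (hv : ContDiff ℝ 1 v) : Continuous (LieD f v) :=
  (hv.continuous_fderiv one_ne_zero).clm_apply (continuous_const.prodMk hf)

theorem hasDerivAt_comp_trajectory {n : ℕ} {f : ℝ × Vec n → Vec n} {x : ℝ → Vec n} {t : ℝ}
    (hx : HasDerivAt x (f (t, x t)) t) {v : ℝ × Vec n → ℝ} (hv : ContDiff ℝ 1 v) :
    HasDerivAt (fun s => v (s, x s)) (LieD f v (t, x t)) t :=
  ((hv.differentiable one_ne_zero) (t, x t)).hasFDerivAt.comp_hasDerivAt t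
    ((hasDerivAt_id t).prodMk hx)

/-- fundamental Liouville identity along a single trajectory, both in
FTC form and in the measure form with `μ₀ = δ_{x(0)}`, `μ_p = δ_{(t_p, x(t_p))}` and `μ`
the occupation measure of `t ↦ (t, x t)` on `[0, t_p]`. -/
theorem liouville_single_trajectory {n : ℕ} (T : ℝ) (hT : 0 < T)
    (f : ℝ × Vec n → Vec n) (hf : Continuous f)
    (x : ℝ → Vec n) (hx : ∀ t ∈ Icc (0 : ℝ) T, HasDerivAt x (f (t, x t)) t)
    (tp : ℝ) (htp : tp ∈ Icc (0 : ℝ) T)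
    (v : ℝ × Vec n → ℝ) (hv : ContDiff ℝ 1 v) :
    v (tp, x tp) = v (0, x 0) + (∫ t in (0 : ℝ)..tp, LieD f v (t, x t)) ∧
    (∫ z, v z ∂(Measure.dirac ((tp, x tp) : ℝ × Vec n))) =
      (∫ x0, v (0, x0) ∂(Measure.dirac (x 0))) +
        ∫ z, LieD f v z ∂(Measure.map (fun t => (t, x t)) (volume.restrict (Icc 0 tp))) := by
  have hx' : ∀ t ∈ Icc (0 : ℝ) tp, HasDerivAt x (f (t, x t)) t :=
    fun t ht => hx t ⟨ht.1, ht.2.trans htp.2⟩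
  have hcurve : ContinuousOn (fun t => (t, x t)) (Icc 0 tp) :=
    continuousOn_id.prodMk fun t ht => (hx' t ht).continuousAt.continuousWithinAt
  have hL := continuous_lieD hf hv
  have hFTC : v (tp, x tp) = v (0, x 0) + ∫ t in (0 : ℝ)..tp, LieD f v (t, x t) := by
    rw [intervalIntegral.integral_eq_sub_of_hasDerivAt (f := fun t => v (t, x t))
      (fun t ht => hasDerivAt_comp_trajectory (hx' t (uIcc_of_le htp.1 ▸ ht)) hv)
      ((hL.comp_continuousOn hcurve).intervalIntegrable_of_Icc htp.1)]
    ring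
  refine ⟨hFTC, ?_⟩
  rw [integral_dirac, integral_dirac,
    integral_map (hcurve.aemeasurable measurableSet_Icc) hL.aestronglyMeasurable,
    integral_Icc_eq_integral_Ioc, ← intervalIntegral.integral_of_le htp.1]
  exact hFTC
end
end

section
/- Measure-program lower bound (Theorem 1): Fix T > 0, compact sets X ⊆ ℝⁿ, X₀ ⊆ X, X_u ⊆ X, a function f : ℝ × ℝⁿ → ℝⁿ locally Lipschitz on [0,T] × X, and a continuous cost c : ℝⁿ × ℝⁿ → ℝ on X × X_u. Let P* be the infimum of c(x(t_p | x₀), y) over all t_p ∈ [0,T], initial conditions x₀ ∈ X₀, and points y ∈ X_u, where x(· | x₀) solves ẋ = f(t,x) with x(0) = x₀ and x(t | x₀) ∈ X for all t ∈ [0, t_p]. Let p* be the infimum of ∫ c(x,y) dη over all feasible measure tuples (μ₀, μ_p, μ, η). Then p* ≤ P*: for every admissible trajectory tuple (y, x₀, t_p) achieving distance P = c(x(t_p | x₀), y) there exists a feasible measure tuple (namely μ₀ = δ_{x₀}, μ_p = δ_{t_p} ⊗ δ_{x(t_p|x₀)}, μ the occupation measure of t ↦ (t, x(t | x₀)) on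 [0, t_p], and η = δ_{x(t_p|x₀)} ⊗ δ_y) whose objective value equals P. -/
open MeasureTheory Set

noncomputable section

/-- A feasible measure tuple `(μ₀, μ_p, μ, η)` for the distance-estimation measure
program: finite nonnegative Borel measures supported on `X₀`, `[0,T] × X`, `[0,T] × X`
and `X × X_u` respectively, with `μ₀` a probability measure, satisfying Liouville's
equation for all `C¹` test functions and the `x`-marginal matching constraint for all
continuous test functions. -/
def Feasible {n : ℕ} (T : ℝ) (X X0 Xu : Set (Vec n)) (f : ℝ × Vec n → Vec n)
    (μ0 : Measure (Vec n)) (μp μ : Measure (ℝ × Vec n))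
    (η : Measure (Vec n × Vec n)) : Prop :=
  IsFiniteMeasure μ0 ∧ IsFiniteMeasure μp ∧ IsFiniteMeasure μ ∧ IsFiniteMeasure η ∧
  μ0 X0ᶜ = 0 ∧ μp ((Icc 0 T ×ˢ X)ᶜ) = 0 ∧ μ ((Icc 0 T ×ˢ X)ᶜ) = 0 ∧
  η ((X ×ˢ Xu)ᶜ) = 0 ∧ μ0 X0 = 1 ∧
  (∀ v : ℝ × Vec n → ℝ, ContDiff ℝ 1 v →
    (∫ z, v z ∂μp) = (∫ x, v (0, x) ∂μ0) + ∫ z, LieD f v z ∂μ) ∧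
  (∀ w : Vec n → ℝ, Continuous w → (∫ p, w p.1 ∂η) = ∫ z, w z.2 ∂μp)

/-- An admissible trajectory: `t_p ∈ [0,T]`, `x(0) ∈ X₀`, `x` solves `ẋ = f(t,x)` on
`[0, t_p]` and remains in `X` there. -/
def Admissible {n : ℕ} (T : ℝ) (X X0 : Set (Vec n)) (f : ℝ × Vec n → Vec n)
    (x : ℝ → Vec n) (tp : ℝ) : Prop :=
  tp ∈ Icc 0 T ∧ x 0 ∈ X0 ∧ (∀ t ∈ Icc 0 tp, HasDerivAt x (f (t, x t)) t) ∧
  ∀ t ∈ Icc 0 tp, x t ∈ X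

/-- The Lie derivative of a `C¹` function is continuous wherever the vector field is. -/
theorem ContinuousOn.lieD {n : ℕ} {f : ℝ × Vec n → Vec n} {s : Set (ℝ × Vec n)}
    (hf : ContinuousOn f s) {v : ℝ × Vec n → ℝ} (hv : ContDiff ℝ 1 v) :
    ContinuousOn (LieD f v) s :=
  (hv.continuous_fderiv one_ne_zero).continuousOn.clm_apply (continuousOn_const.prodMk hf)

namespace Admissible

variable {n : ℕ} {T : ℝ} {X X0 : Set (Vec n)} {f : ℝ × Vec n → Vec n} {x : ℝ → Vec n} {tp : ℝ}

theorem continuousOn_graph (h : Admissible T X X0 f x tp) :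
    ContinuousOn (fun t => (t, x t)) (Icc 0 tp) :=
  continuousOn_id.prodMk fun t ht => (h.2.2.1 t ht).continuousAt.continuousWithinAt

theorem mapsTo_graph (h : Admissible T X X0 f x tp) :
    MapsTo (fun t => (t, x t)) (Icc 0 tp) (Icc 0 T ×ˢ X) :=
  fun t ht => ⟨⟨ht.1, ht.2.trans h.1.2⟩, h.2.2.2 t ht⟩

theorem aemeasurable_graph (h : Admissible T X X0 f x tp) :
    AEMeasurable (fun t => (t, x t)) (volume.restrict (Icc 0 tp)) :=
  h.continuousOn_graph.aemeasurable measurableSet_Icc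

/-- The occupation measure of an admissible trajectory is supported on `[0, T] × X`. -/
theorem occupation_compl_eq_zero (h : Admissible T X X0 f x tp) (hX : IsCompact X) :
    Measure.map (fun t => (t, x t)) (volume.restrict (Icc 0 tp)) (Icc 0 T ×ˢ X)ᶜ = 0 := by
  have hm : MeasurableSet (Icc 0 T ×ˢ X) := measurableSet_Icc.prod hX.measurableSet
  refine (ae_map_iff h.aemeasurable_graph hm).2 ?_
  filter_upwards [ae_restrict_mem measurableSet_Icc] with t ht using h.mapsTo_graph ht

/-- Liouville's equation for the occupation measure of an admissible trajectory. -/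
theorem integral_lieD_occupation (h : Admissible T X X0 f x tp) (hX : IsCompact X)
    (hf : ContinuousOn f (Icc 0 T ×ˢ X)) {v : ℝ × Vec n → ℝ} (hv : ContDiff ℝ 1 v) :
    ∫ z, LieD f v z ∂(Measure.map (fun t => (t, x t)) (volume.restrict (Icc 0 tp))) =
      v (tp, x tp) - v (0, x 0) := by
  have hm : MeasurableSet (Icc 0 T ×ˢ X) := measurableSet_Icc.prod hX.measurableSet
  have hL : ContinuousOn (LieD f v) (Icc 0 T ×ˢ X) := hf.lieD hv
  have hsm : AEStronglyMeasurable (LieD f v)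
      (Measure.map (fun t => (t, x t)) (volume.restrict (Icc 0 tp))) := by
    rw [← Measure.restrict_eq_self_of_ae_mem
      (show ∀ᵐ z ∂_, z ∈ Icc 0 T ×ˢ X from h.occupation_compl_eq_zero hX)]
    exact hL.aestronglyMeasurable hm
  rw [integral_map h.aemeasurable_graph hsm, integral_Icc_eq_integral_Ioc,
    ← intervalIntegral.integral_of_le h.1.1]
  have hI : uIcc 0 tp = Icc 0 tp := uIcc_of_le h.1.1
  refine intervalIntegral.integral_eq_sub_of_hasDerivAt (f := fun s => v (s, x s))
    (fun t ht => hasDerivAt_comp_trajectory (h.2.2.1 t (hI ▸ ht)) hv) ?_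
  refine ContinuousOn.intervalIntegrable ?_
  rw [hI]
  exact hL.comp h.continuousOn_graph h.mapsTo_graph

/-- The Dirac and occupation measures of an admissible trajectory are feasible. -/
theorem feasible (h : Admissible T X X0 f x tp) {Xu : Set (Vec n)} (hX : IsCompact X)
    (hf : ContinuousOn f (Icc 0 T ×ˢ X)) {y : Vec n} (hy : y ∈ Xu) :
    Feasible T X X0 Xu f (Measure.dirac (x 0)) (Measure.dirac (tp, x tp))
      (Measure.map (fun t => (t, x t)) (volume.restrict (Icc 0 tp)))
      ((Measure.dirac (x tp)).prod (Measure.dirac y)) := by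
  have htp : tp ∈ Icc 0 tp := right_mem_Icc.2 h.1.1
  have hxtp : x tp ∈ X := h.2.2.2 tp htp
  refine ⟨inferInstance, inferInstance, inferInstance, inferInstance, ?_, ?_,
    h.occupation_compl_eq_zero hX, ?_, ?_, fun v hv => ?_, fun w _ => ?_⟩
  · simp [h.2.1]
  · simp [hxtp, h.1.1, h.1.2]
  · simp [Measure.dirac_prod_dirac, hxtp, hy]
  · simp [h.2.1]
  · rw [h.integral_lieD_occupation hX hf hv]
    simp
  · simp [Measure.dirac_prod_dirac]

end Admissible

/-- With terminal time `0` there is an admissible trajectory from every initial condition. -/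
theorem exists_admissible {n : ℕ} {T : ℝ} (hT : 0 ≤ T) {X X0 : Set (Vec n)} (hX0X : X0 ⊆ X)
    (f : ℝ × Vec n → Vec n) {x₀ : Vec n} (hx₀ : x₀ ∈ X0) :
    Admissible T X X0 f (fun t => x₀ + t • f (0, x₀)) 0 := by
  refine ⟨⟨le_rfl, hT⟩, by simpa using hx₀, fun t ht => ?_, fun t ht => ?_⟩ <;>
    obtain rfl : t = 0 := le_antisymm ht.2 ht.1
  · simpa using ((hasDerivAt_id (0 : ℝ)).smul_const (f (0, x₀))).const_add x₀
  · simpa using hX0X hx₀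

namespace Feasible

variable {n : ℕ} {T : ℝ} {X X0 Xu : Set (Vec n)} {f : ℝ × Vec n → Vec n}
  {μ0 : Measure (Vec n)} {μp μ : Measure (ℝ × Vec n)} {η : Measure (Vec n × Vec n)}

/-- In a feasible tuple, `η` has total mass one. -/
theorem real_univ_eq_one (h : Feasible T X X0 Xu f μ0 μp μ η) : η.real univ = 1 := by
  obtain ⟨_, _, _, _, h0, _, _, _, h1, hL, hw⟩ := h
  have hμ0 : μ0.real univ = 1 := by
    have : μ0 univ = μ0 X0 := (measure_eq_measure_of_null_sdiff (subset_univ X0)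
      (by rwa [← compl_eq_univ_sdiff])).symm
    simp [Measure.real, this, h1]
  have hp := hL (fun _ => 1) contDiff_const
  have he := hw (fun _ => 1) continuous_const
  simp only [LieD, integral_const, smul_eq_mul, mul_one, fderiv_fun_const, Pi.zero_apply,
    zero_apply, mul_zero, add_zero] at hp he
  rw [he, hp, hμ0]

theorem nonempty_initial (h : Feasible T X X0 Xu f μ0 μp μ η) : X0.Nonempty := by
  rw [nonempty_iff_ne_empty]
  rintro rfl
  obtain ⟨_, _, _, _, _, _, _, _, h1, _⟩ := h
  simp at h1

theorem nonempty_target (h : Feasible T X X0 Xu f μ0 μp μ η) : Xu.Nonempty := by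
  rw [nonempty_iff_ne_empty]
  rintro rfl
  have h1 := h.real_univ_eq_one
  obtain ⟨_, _, _, _, _, _, _, hη, _⟩ := h
  simp only [prod_empty, compl_empty] at hη
  simp [Measure.real, hη] at h1

/-- The objective of a feasible tuple is bounded by any bound of the cost on `X × X_u`. -/
theorem abs_integral_le (h : Feasible T X X0 Xu f μ0 μp μ η) {c : Vec n × Vec n → ℝ} {C : ℝ}
    (hC : ∀ p ∈ X ×ˢ Xu, ‖c p‖ ≤ C) : |∫ p, c p ∂η| ≤ C := by
  have h1 := h.real_univ_eq_one
  obtain ⟨_, _, _, _, _, _, _, hη, _⟩ := h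
  have hae : ∀ᵐ p ∂η, p ∈ X ×ˢ Xu := hη
  have := norm_integral_le_of_norm_le_const (hae.mono hC)
  rwa [h1, mul_one] at this

end Feasible

/-- **Theorem 1**: every admissible trajectory tuple yields a feasible
measure tuple (Diracs plus the occupation measure) with the same objective value, and
consequently the measure-program value `p*` is a lower bound on the trajectory value
`P*`. -/
theorem measure_program_lower_bound {n : ℕ} (T : ℝ) (hT : 0 < T)
    (X X0 Xu : Set (Vec n)) (hX : IsCompact X) (hX0 : IsCompact X0) (hXu : IsCompact Xu)
    (hX0X : X0 ⊆ X) (hXuX : Xu ⊆ X)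
    (f : ℝ × Vec n → Vec n) (K : NNReal) (hf : LipschitzOnWith K f (Icc 0 T ×ˢ X))
    (c : Vec n × Vec n → ℝ) (hc : ContinuousOn c (X ×ˢ Xu)) :
    (∀ (x : ℝ → Vec n) (tp : ℝ) (y : Vec n), Admissible T X X0 f x tp → y ∈ Xu →
      Feasible T X X0 Xu f (Measure.dirac (x 0)) (Measure.dirac (tp, x tp))
        (Measure.map (fun t => (t, x t)) (volume.restrict (Icc 0 tp)))
        ((Measure.dirac (x tp)).prod (Measure.dirac y)) ∧
      (∫ p, c p ∂((Measure.dirac (x tp)).prod (Measure.dirac y))) = c (x tp, y)) ∧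
    sInf {r | ∃ μ0 μp μ η, Feasible T X X0 Xu f μ0 μp μ η ∧ r = ∫ p, c p ∂η} ≤
      sInf {r | ∃ (x : ℝ → Vec n) (tp : ℝ) (y : Vec n),
        Admissible T X X0 f x tp ∧ y ∈ Xu ∧ r = c (x tp, y)} := by
  have hobj : ∀ a b : Vec n, (∫ p, c p ∂((Measure.dirac a).prod (Measure.dirac b))) = c (a, b) :=
    fun a b => by rw [Measure.dirac_prod_dirac, integral_dirac]
  have hfeas : ∀ (x : ℝ → Vec n) (tp : ℝ) (y : Vec n), Admissible T X X0 f x tp → y ∈ Xu →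
      Feasible T X X0 Xu f (Measure.dirac (x 0)) (Measure.dirac (tp, x tp))
        (Measure.map (fun t => (t, x t)) (volume.restrict (Icc 0 tp)))
        ((Measure.dirac (x tp)).prod (Measure.dirac y)) :=
    fun x tp y h hy => h.feasible hX hf.continuousOn hy
  refine ⟨fun x tp y h hy => ⟨hfeas x tp y h hy, hobj _ _⟩, ?_⟩
  by_cases hne : X0.Nonempty ∧ Xu.Nonempty
  · obtain ⟨⟨x₀, hx₀⟩, y, hy⟩ := hne
    obtain ⟨C, hC⟩ := (hX.prod hXu).exists_bound_of_continuousOn hc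
    refine csInf_le_csInf ⟨-C, ?_⟩
      ⟨_, _, 0, y, exists_admissible hT.le hX0X f hx₀, hy, rfl⟩ ?_
    · rintro _ ⟨μ0, μp, μ, η, h, rfl⟩
      exact (abs_le.1 (h.abs_integral_le hC)).1
    · rintro _ ⟨x, tp, y, h, hy, rfl⟩
      exact ⟨_, _, _, _, hfeas x tp y h hy, (hobj _ _).symm⟩
  · have hmeas : {r | ∃ μ0 μp μ η, Feasible T X X0 Xu f μ0 μp μ η ∧ r = ∫ p, c p ∂η} = ∅ := by
      refine eq_empty_of_forall_notMem ?_
      rintro _ ⟨μ0, μp, μ, η, h, -⟩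
      exact hne ⟨h.nonempty_initial, h.nonempty_target⟩
    have htraj : {r | ∃ (x : ℝ → Vec n) (tp : ℝ) (y : Vec n),
        Admissible T X X0 f x tp ∧ y ∈ Xu ∧ r = c (x tp, y)} = ∅ := by
      refine eq_empty_of_forall_notMem ?_
      rintro _ ⟨x, tp, y, h, hy, -⟩
      exact hne ⟨⟨x 0, h.2.1⟩, y, hy⟩
    rw [hmeas, htraj]
end
end

section
/- Certificate soundness along trajectories: Fix T > 0, compact sets X ⊆ ℝⁿ, X₀ ⊆ X, X_u ⊆ X, a continuous f : ℝ × ℝⁿ → ℝⁿ, and a continuous cost c on X × X_u. Suppose (γ, v, w) is a dual-feasible triple. Then for every differentiable curve x : [0, t_p] → ℝⁿ with t_p ∈ [0,T], x(0) ∈ X₀, x'(t) = f(t, x(t)) and x(t) ∈ X for all t ∈ [0, t_p], and for every y ∈ X_u, one has c(x(t_p), y) ≥ γ. In particular, γ is a lower bound on the distance of closest approach of all trajectories to the unsafe set X_u. -/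
open MeasureTheory Set

noncomputable section

/-- A dual-feasible triple `(γ, v, w)` for the distance-estimation function program. -/
def DualFeasible {n : ℕ} (T : ℝ) (X X0 Xu : Set (Vec n)) (f : ℝ × Vec n → Vec n)
    (c : Vec n × Vec n → ℝ) (γ : ℝ) (v : ℝ × Vec n → ℝ) (w : Vec n → ℝ) : Prop :=
  ContDiff ℝ 1 v ∧ Continuous w ∧
  (∀ x ∈ X0, γ ≤ v (0, x)) ∧
  (∀ x ∈ X, ∀ y ∈ Xu, w x ≤ c (x, y)) ∧
  (∀ t ∈ Icc 0 T, ∀ x ∈ X, v (t, x) ≤ w x) ∧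
  (∀ t ∈ Icc 0 T, ∀ x ∈ X, 0 ≤ LieD f v (t, x))

/-- certificate soundness along trajectories.  If `(γ, v, w)` is
dual-feasible, then along any trajectory of `ẋ = f(t,x)` starting in `X₀` that stays in
`X` up to time `t_p ∈ [0,T]`, and for any `y ∈ X_u`, one has `c(x(t_p), y) ≥ γ`. -/
theorem certificate_soundness {n : ℕ} (T : ℝ) (hT : 0 < T)
    (X X0 Xu : Set (Vec n)) (hX : IsCompact X) (hX0 : IsCompact X0) (hXu : IsCompact Xu)
    (hX0X : X0 ⊆ X) (hXuX : Xu ⊆ X)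
    (f : ℝ × Vec n → Vec n) (hf : Continuous f)
    (c : Vec n × Vec n → ℝ) (hc : ContinuousOn c (X ×ˢ Xu))
    (γ : ℝ) (v : ℝ × Vec n → ℝ) (w : Vec n → ℝ)
    (hd : DualFeasible T X X0 Xu f c γ v w)
    (x : ℝ → Vec n) (tp : ℝ) (htp : tp ∈ Icc (0 : ℝ) T) (hx0 : x 0 ∈ X0)
    (hode : ∀ t ∈ Icc (0 : ℝ) tp, HasDerivAt x (f (t, x t)) t)
    (hX' : ∀ t ∈ Icc (0 : ℝ) tp, x t ∈ X)
    (y : Vec n) (hy : y ∈ Xu) :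
    γ ≤ c (x tp, y) := by
  obtain ⟨hv, -, hinit, hwc, hvw, hL⟩ := hd
  have hmem : ∀ t ∈ Icc (0 : ℝ) tp, t ∈ Icc (0 : ℝ) T := fun t ht => ⟨ht.1, ht.2.trans htp.2⟩
  have h0 : (0 : ℝ) ∈ Icc (0 : ℝ) tp := left_mem_Icc.2 htp.1
  have h1 : tp ∈ Icc (0 : ℝ) tp := right_mem_Icc.2 htp.1
  have hder : ∀ t ∈ Icc (0 : ℝ) tp,
      HasDerivAt (fun s => v (s, x s)) (LieD f v (t, x t)) t := fun t ht =>
    ((hv.differentiable one_ne_zero) (t, x t)).hasFDerivAt.comp_hasDerivAt t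
      ((hasDerivAt_id t).prodMk (hode t ht))
  have hmono : MonotoneOn (fun s => v (s, x s)) (Icc 0 tp) := by
    refine monotoneOn_of_hasDerivWithinAt_nonneg (f' := fun t => LieD f v (t, x t))
      (convex_Icc 0 tp) (fun t ht => (hder t ht).continuousAt.continuousWithinAt)
      (fun t ht => (hder t (interior_subset ht)).hasDerivWithinAt) (fun t ht => ?_)
    have ht' := interior_subset ht
    exact hL t (hmem t ht') (x t) (hX' t ht')
  calc γ ≤ v (0, x 0) := hinit _ hx0
    _ ≤ v (tp, x tp) := hmono h0 h1 htp.1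
    _ ≤ w (x tp) := hvw tp htp _ (hX' tp h1)
    _ ≤ c (x tp, y) := hwc _ (hX' tp h1) y hy
end
end

section
/- Strong duality for the distance-estimation linear programs (Theorem 2): Fix T > 0, compact sets X ⊆ ℝⁿ, X₀ ⊆ X, X_u ⊆ X, a function f : ℝ × ℝⁿ → ℝⁿ that is Lipschitz in each argument on [0,T] × X, and a continuous cost c on X × X_u. Assume the non-return property: if a trajectory x(· | x₀) starting in X₀ touches the boundary ∂X at some time t ∈ [0,T], then x(t' | x₀) ∉ X for all t' ∈ (t, T]. Then the measure program and the function program are strongly dual: p* = d*, where p* is the infimum of ∫ c dη over feasible measure tuples (μ₀, μ_p, μ, η) and d* is the supremum of γ over dual-feasible triples (γ, v, w); moreover the optimum of the measure program is attained. -/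
open MeasureTheory Set

noncomputable section

/-- A linear functional that is nonnegative wherever `B` is nonnegative factors through `B` as a
positive functional, provided that the range of `B` is cofinal. -/
theorem exists_nonneg_linearMap_comp_eq {V E : Type*} [AddCommGroup V] [Module ℝ V]
    [AddCommGroup E] [PartialOrder E] [IsOrderedAddMonoid E] [Module ℝ E] [PosSMulMono ℝ E]
    (B : V →ₗ[ℝ] E) (φ : V →ₗ[ℝ] ℝ) (hφ : ∀ u, 0 ≤ B u → 0 ≤ φ u)
    (hB : ∀ e, ∃ u, 0 ≤ B u + e) :
    ∃ Λ : E →ₗ[ℝ] ℝ, (∀ e, 0 ≤ e → 0 ≤ Λ e) ∧ ∀ u, Λ (B u) = φ u := by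
  let s : PointedCone ℝ (V × E) :=
    { carrier := {p | 0 ≤ B p.1 + p.2}
      add_mem' := by
        intro a b ha hb
        have h := add_nonneg ha hb
        simpa [add_add_add_comm] using h
      zero_mem' := by simp
      smul_mem' := by
        rintro ⟨r, hr⟩ x hx
        have h : (0 : E) ≤ r • (B x.1 + x.2) := smul_nonneg hr hx
        simpa [smul_add, Nonneg.mk_smul] using h }
  have hs : ∀ p : V × E, p ∈ s ↔ 0 ≤ B p.1 + p.2 := fun p => Iff.rfl
  obtain ⟨g, hg, hpos⟩ := riesz_extension s
    ((φ ∘ₗ LinearMap.fst ℝ V E).toPMap (LinearMap.range (LinearMap.inl ℝ V E)))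
    (by
      rintro ⟨_, ⟨u, rfl⟩⟩ h
      rw [hs] at h
      exact hφ u (by simpa using h))
    (by
      rintro ⟨u, e⟩
      obtain ⟨u', hu'⟩ := hB e
      refine ⟨⟨_, ⟨u' - u, rfl⟩⟩, ?_⟩
      rw [hs]
      simpa using hu')
  have hg' : ∀ u, g (u, 0) = φ u := fun u => hg ⟨_, ⟨u, rfl⟩⟩
  refine ⟨g ∘ₗ LinearMap.inr ℝ V E, fun e he => hpos _ (by simpa [hs] using he), fun u => ?_⟩
  have h₁ : 0 ≤ g (u, -B u) := hpos _ (by simp [hs])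
  have h₂ : 0 ≤ g (-u, B u) := hpos _ (by simp [hs])
  have e₁ : g (u, -B u) = φ u - g (0, B u) := by
    rw [← hg', ← map_sub]; simp
  have e₂ : g (-u, B u) = -φ u + g (0, B u) := by
    rw [← hg', ← map_neg, ← map_add]; simp
  simp only [LinearMap.comp_apply, LinearMap.inr_apply]
  linarith

/-- Riesz–Markov–Kakutani representation on a compact subset of an ambient space. -/
theorem exists_measure_integral_eq_of_isCompact {Z : Type*} [TopologicalSpace Z] [T2Space Z]
    [MeasurableSpace Z] [BorelSpace Z] {S : Set Z} (hS : IsCompact S)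
    (Λ : C(S, ℝ) →ₗ[ℝ] ℝ) (hΛ : ∀ g, 0 ≤ g → 0 ≤ Λ g) :
    ∃ μ : Measure Z, IsFiniteMeasure μ ∧ μ Sᶜ = 0 ∧
      ∀ (g : Z → ℝ) (hg : ContinuousOn g S), ∫ z, g z ∂μ = Λ ⟨S.domRestrict g, hg.domRestrict⟩ := by
  have : CompactSpace S := isCompact_iff_compactSpace.mp hS
  have hSm : MeasurableSet S := hS.isClosed.measurableSet
  let Λ' : CompactlySupportedContinuousMap S ℝ →ₚ[ℝ] ℝ := PositiveLinearMap.mk₀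
    { toFun := fun g => Λ g.toContinuousMap
      map_add' := fun a b => map_add Λ a.toContinuousMap b.toContinuousMap
      map_smul' := fun r a => map_smul Λ r a.toContinuousMap }
    (fun g hg => hΛ _ hg)
  have hemb := MeasurableEmbedding.subtype_coe hSm
  refine ⟨(RealRMK.rieszMeasure Λ').map (↑), inferInstance, ?_, fun g hg => ?_⟩
  · rw [hemb.map_apply]
    simp
  · rw [hemb.integral_map]
    exact RealRMK.integral_rieszMeasure Λ'
      (CompactlySupportedContinuousMap.continuousMapEquiv ⟨S.domRestrict g, hg.domRestrict⟩)

theorem integrable_of_continuousOn_isCompact {Z : Type*} [TopologicalSpace Z] [T2Space Z]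
    [MeasurableSpace Z] [BorelSpace Z] {S : Set Z} (hS : IsCompact S) {μ : Measure Z}
    [IsFiniteMeasure μ] (hμ : μ Sᶜ = 0) {g : Z → ℝ} (hg : ContinuousOn g S) :
    Integrable g μ := by
  have h := hg.integrableOn_compact' (μ := μ) hS hS.isClosed.measurableSet
  rwa [IntegrableOn, Measure.restrict_eq_self_of_ae_mem (ae_iff.mpr hμ)] at h

theorem continuousOn_lieD {n : ℕ} {S : Set (ℝ × Vec n)} {f : ℝ × Vec n → Vec n}
    (hf : ContinuousOn f S) {v : ℝ × Vec n → ℝ} (hv : ContDiff ℝ 1 v) :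
    ContinuousOn (LieD f v) S :=
  (hv.continuous_fderiv one_ne_zero).continuousOn.clm_apply (continuousOn_const.prodMk hf)

theorem lieD_add {n : ℕ} (f : ℝ × Vec n → Vec n) {v v' : ℝ × Vec n → ℝ} (hv : ContDiff ℝ 1 v)
    (hv' : ContDiff ℝ 1 v') (p : ℝ × Vec n) : LieD f (v + v') p = LieD f v p + LieD f v' p := by
  simp [LieD, fderiv_add (hv.differentiable one_ne_zero p) (hv'.differentiable one_ne_zero p)]

theorem lieD_smul {n : ℕ} (f : ℝ × Vec n → Vec n) {v : ℝ × Vec n → ℝ} (hv : ContDiff ℝ 1 v)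
    (r : ℝ) (p : ℝ × Vec n) : LieD f (r • v) p = r * LieD f v p := by
  simp [LieD, fderiv_const_smul (hv.differentiable one_ne_zero p) r]

/-- Weak duality between the measure program and the function program. -/
theorem Feasible.le_integral {n : ℕ} {T : ℝ} {X X0 Xu : Set (Vec n)} (hX : IsCompact X)
    (hX0 : IsCompact X0) (hXu : IsCompact Xu) {f : ℝ × Vec n → Vec n}
    {c : Vec n × Vec n → ℝ} (hc : ContinuousOn c (X ×ˢ Xu))
    {μ0 : Measure (Vec n)} {μp μ : Measure (ℝ × Vec n)} {η : Measure (Vec n × Vec n)}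
    (h : Feasible T X X0 Xu f μ0 μp μ η) {γ : ℝ} {v : ℝ × Vec n → ℝ} {w : Vec n → ℝ}
    (hd : DualFeasible T X X0 Xu f c γ v w) : γ ≤ ∫ p, c p ∂η := by
  obtain ⟨_, _, _, _, s0, sp, sm, sη, h1, hL, hM⟩ := h
  obtain ⟨hv, hw, d0, dc, dv, dL⟩ := hd
  have hK : IsCompact (Icc 0 T ×ˢ X) := isCompact_Icc.prod hX
  have ae {Z : Type _} [MeasurableSpace Z] {ν : Measure Z} {S : Set Z} (hS : ν Sᶜ = 0) :
      ∀ᵐ z ∂ν, z ∈ S := ae_iff.mpr hS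
  have hprob : μ0.real univ = 1 := by
    rw [measureReal_def, ← measure_add_measure_compl hX0.isClosed.measurableSet, s0, h1]
    simp
  have hγ : γ ≤ ∫ x, v (0, x) ∂μ0 := by
    have := integral_mono_ae (integrable_const γ)
      (integrable_of_continuousOn_isCompact hX0 s0
        (g := fun x => v (0, x)) (hv.continuous.comp (by fun_prop)).continuousOn)
      ((ae s0).mono fun x hx => d0 x hx)
    simpa [hprob] using this
  have hLv : 0 ≤ ∫ z, LieD f v z ∂μ :=
    integral_nonneg_of_ae ((ae sm).mono fun z hz => dL z.1 hz.1 z.2 hz.2)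
  have hvw : ∫ z, v z ∂μp ≤ ∫ z, w z.2 ∂μp :=
    integral_mono_ae (integrable_of_continuousOn_isCompact hK sp hv.continuous.continuousOn)
      (integrable_of_continuousOn_isCompact hK sp (hw.comp continuous_snd).continuousOn)
      ((ae sp).mono fun z hz => dv z.1 hz.1 z.2 hz.2)
  have hwc : ∫ p, w p.1 ∂η ≤ ∫ p, c p ∂η :=
    integral_mono_ae
      (integrable_of_continuousOn_isCompact (hX.prod hXu) sη
        (hw.comp continuous_fst).continuousOn)
      (integrable_of_continuousOn_isCompact (hX.prod hXu) sη hc)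
      ((ae sη).mono fun z hz => dc z.1 hz.1 z.2 hz.2)
  linarith [hL v hv, hM w hw]

/-- The space of continuously differentiable functions of time and state. -/
def contDiffOneSubmodule (n : ℕ) : Submodule ℝ (ℝ × Vec n → ℝ) where
  carrier := {v | ContDiff ℝ 1 v}
  add_mem' hv hw := by
    rw [mem_ofPred_eq] at *
    exact hv.add hw
  zero_mem' := by
    rw [mem_ofPred_eq]
    exact contDiff_const
  smul_mem' r _ hv := by
    rw [mem_ofPred_eq] at *
    exact hv.const_smul r

theorem mem_contDiffOneSubmodule {n : ℕ} {v : ℝ × Vec n → ℝ} :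
    v ∈ contDiffOneSubmodule n ↔ ContDiff ℝ 1 v := Iff.rfl

theorem contDiff_contDiffOneSubmodule {n : ℕ} (v : contDiffOneSubmodule n) :
    ContDiff ℝ 1 (v : ℝ × Vec n → ℝ) := v.2

/-- The constraints of the homogenized function program: `(v, w, γ, s)` is sent to the slacks
`(v(0, ·) - γ, w - v, L_f v, s c - w)`. -/
def dualConstraint {n : ℕ} {T : ℝ} {X : Set (Vec n)} (X0 : Set (Vec n)) {Xu : Set (Vec n)}
    {f : ℝ × Vec n → Vec n} (hf : ContinuousOn f (Icc 0 T ×ˢ X)) {c : Vec n × Vec n → ℝ}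
    (hc : ContinuousOn c (X ×ˢ Xu)) :
    (contDiffOneSubmodule n × C(Vec n, ℝ) × ℝ × ℝ) →ₗ[ℝ]
      C(X0, ℝ) × C(Icc 0 T ×ˢ X, ℝ) × C(Icc 0 T ×ˢ X, ℝ) × C(X ×ˢ Xu, ℝ) where
  toFun u :=
    (⟨fun x => u.1.1 (0, x) - u.2.2.1,
        ((contDiff_contDiffOneSubmodule u.1).continuous.comp (by fun_prop)).sub continuous_const⟩,
      ⟨fun z => u.2.1 z.1.2 - u.1.1 z,
        (u.2.1.continuous.comp (by fun_prop)).sub ((contDiff_contDiffOneSubmodule u.1).continuous.comp (by fun_prop))⟩,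
      ⟨fun z => LieD f u.1.1 z, (continuousOn_lieD hf (contDiff_contDiffOneSubmodule u.1)).domRestrict⟩,
      ⟨fun p => u.2.2.2 * c p - u.2.1 p.1.1,
        (continuous_const.mul hc.domRestrict).sub (u.2.1.continuous.comp (by fun_prop))⟩)
  map_add' a b := by
    refine Prod.ext ?_ (Prod.ext ?_ (Prod.ext ?_ ?_)) <;> ext z
    · simp; ring
    · simp; ring
    · exact lieD_add f (contDiff_contDiffOneSubmodule a.1) (contDiff_contDiffOneSubmodule b.1) z
    · change (a.2.2.2 + b.2.2.2) * c z - (a.2.1 z.1.1 + b.2.1 z.1.1) =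
        (a.2.2.2 * c z - a.2.1 z.1.1) + (b.2.2.2 * c z - b.2.1 z.1.1)
      ring
  map_smul' r a := by
    refine Prod.ext ?_ (Prod.ext ?_ (Prod.ext ?_ ?_)) <;> ext z
    · simp; ring
    · simp; ring
    · exact lieD_smul f (contDiff_contDiffOneSubmodule a.1) r z
    · change r * a.2.2.2 * c z - r * a.2.1 z.1.1 = r * (a.2.2.2 * c z - a.2.1 z.1.1)
      ring

theorem dualConstraint_nonneg_iff {n : ℕ} {T : ℝ} {X X0 Xu : Set (Vec n)}
    {f : ℝ × Vec n → Vec n} (hf : ContinuousOn f (Icc 0 T ×ˢ X)) {c : Vec n × Vec n → ℝ}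
    (hc : ContinuousOn c (X ×ˢ Xu)) (u : contDiffOneSubmodule n × C(Vec n, ℝ) × ℝ × ℝ) :
    0 ≤ dualConstraint X0 hf hc u ↔
      DualFeasible T X X0 Xu f (fun p => u.2.2.2 * c p) u.2.2.1 u.1.1 u.2.1 := by
  have h : 0 ≤ dualConstraint X0 hf hc u ↔
      (∀ x : X0, 0 ≤ u.1.1 (0, x) - u.2.2.1) ∧
      (∀ z : ↥(Icc 0 T ×ˢ X), 0 ≤ u.2.1 z.1.2 - u.1.1 z) ∧
      (∀ z : ↥(Icc 0 T ×ˢ X), 0 ≤ LieD f u.1.1 z) ∧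
      ∀ p : ↥(X ×ˢ Xu), 0 ≤ u.2.2.2 * c p - u.2.1 p.1.1 := Iff.rfl
  rw [h]
  constructor
  · rintro ⟨h0, hp, hm, hη⟩
    exact ⟨(contDiff_contDiffOneSubmodule u.1), u.2.1.continuous, fun x hx => sub_nonneg.mp (h0 ⟨x, hx⟩),
      fun x hx y hy => sub_nonneg.mp (hη ⟨(x, y), hx, hy⟩),
      fun t ht x hx => sub_nonneg.mp (hp ⟨(t, x), ht, hx⟩), fun t ht x hx => hm ⟨(t, x), ht, hx⟩⟩
  · rintro ⟨-, -, d0, dc, dv, dL⟩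
    exact ⟨fun x => sub_nonneg.mpr (d0 x x.2), fun z => sub_nonneg.mpr (dv _ z.2.1 _ z.2.2),
      fun z => dL _ z.2.1 _ z.2.2, fun p => sub_nonneg.mpr (dc _ p.2.1 _ p.2.2)⟩

/-- The range of `dualConstraint` is cofinal: the homogenized function program has a Slater
point. -/
theorem exists_nonneg_dualConstraint_add {n : ℕ} {T : ℝ} {X X0 Xu : Set (Vec n)}
    (hX : IsCompact X) (hX0 : IsCompact X0) (hXu : IsCompact Xu)
    {f : ℝ × Vec n → Vec n} (hf : ContinuousOn f (Icc 0 T ×ˢ X)) {c : Vec n × Vec n → ℝ}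
    (hc : ContinuousOn c (X ×ˢ Xu)) {m : ℝ} (hm : ∀ p ∈ X ×ˢ Xu, m ≤ c p)
    (e : C(X0, ℝ) × C(Icc 0 T ×ˢ X, ℝ) × C(Icc 0 T ×ˢ X, ℝ) × C(X ×ˢ Xu, ℝ)) :
    ∃ u, 0 ≤ dualConstraint X0 hf hc u + e := by
  have hK : IsCompact (Icc 0 T ×ˢ X) := isCompact_Icc.prod hX
  have : CompactSpace X0 := isCompact_iff_compactSpace.mp hX0
  have : CompactSpace ↥(Icc 0 T ×ˢ X) := isCompact_iff_compactSpace.mp hK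
  have : CompactSpace ↥(X ×ˢ Xu) := isCompact_iff_compactSpace.mp (hX.prod hXu)
  obtain ⟨e0, ep, em, eη⟩ := e
  let M : ℝ := ‖e0‖ + ‖ep‖ + ‖em‖ + ‖eη‖
  have b0 : ∀ x, -M ≤ e0 x := fun x => by
    linarith [neg_le_of_abs_le (e0.norm_coe_le_norm x), norm_nonneg ep, norm_nonneg em,
      norm_nonneg eη]
  have bp : ∀ x, -M ≤ ep x := fun x => by
    linarith [neg_le_of_abs_le (ep.norm_coe_le_norm x), norm_nonneg e0, norm_nonneg em,
      norm_nonneg eη]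
  have bm : ∀ x, -M ≤ em x := fun x => by
    linarith [neg_le_of_abs_le (em.norm_coe_le_norm x), norm_nonneg e0, norm_nonneg ep,
      norm_nonneg eη]
  have bη : ∀ x, -M ≤ eη x := fun x => by
    linarith [neg_le_of_abs_le (eη.norm_coe_le_norm x), norm_nonneg e0, norm_nonneg ep,
      norm_nonneg em]
  have hM : 0 ≤ M := by positivity
  let v : ℝ × Vec n → ℝ := fun z => M * z.1 + M * (m - 2 - T)
  have hv : ContDiff ℝ 1 v := (contDiff_const.mul contDiff_fst).add contDiff_const
  have hLv : ∀ z, LieD f v z = M := fun z => by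
    have h : HasFDerivAt v (M • ContinuousLinearMap.fst ℝ ℝ (Vec n)) z :=
      (hasFDerivAt_fst.const_mul M).add_const _
    simp [LieD, h.fderiv]
  refine ⟨(⟨v, mem_contDiffOneSubmodule.mpr hv⟩, ContinuousMap.const _ (M * (m - 1)), M * (m - 2 - T) - M, M), ?_⟩
  refine ⟨fun x => ?_, fun z => ?_, fun z => ?_, fun p => ?_⟩
  · change 0 ≤ v (0, x) - (M * (m - 2 - T) - M) + e0 x
    simp only [v]
    linarith [b0 x]
  · change 0 ≤ M * (m - 1) - v z + ep z
    have : M * z.1.1 ≤ M * T := mul_le_mul_of_nonneg_left z.2.1.2 hM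
    simp only [v]
    linarith [bp z]
  · change 0 ≤ LieD f v z + em z
    rw [hLv]
    linarith [bm z]
  · change 0 ≤ M * c p - M * (m - 1) + eη p
    have : M * m ≤ M * c p := mul_le_mul_of_nonneg_left (hm p p.2) hM
    linarith [bη p]

theorem DualFeasible.le_cost {n : ℕ} {T : ℝ} (hT : 0 ≤ T) {X X0 Xu : Set (Vec n)}
    (hX0X : X0 ⊆ X) {f : ℝ × Vec n → Vec n} {c : Vec n × Vec n → ℝ} {γ : ℝ}
    {v : ℝ × Vec n → ℝ} {w : Vec n → ℝ} (h : DualFeasible T X X0 Xu f c γ v w)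
    {x y : Vec n} (hx : x ∈ X0) (hy : y ∈ Xu) : γ ≤ c (x, y) :=
  (h.2.2.1 x hx).trans <| (h.2.2.2.2.1 0 ⟨le_rfl, hT⟩ x (hX0X hx)).trans <|
    h.2.2.2.1 x (hX0X hx) y hy

/-- Dual feasible triples scale. -/
theorem DualFeasible.smul {n : ℕ} {T : ℝ} {X X0 Xu : Set (Vec n)} {f : ℝ × Vec n → Vec n}
    {c : Vec n × Vec n → ℝ} {γ : ℝ} {v : ℝ × Vec n → ℝ} {w : Vec n → ℝ}
    (h : DualFeasible T X X0 Xu f c γ v w) {r : ℝ} (hr : 0 ≤ r) :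
    DualFeasible T X X0 Xu f (fun p => r * c p) (r * γ) (r • v) (r • w) := by
  obtain ⟨hv, hw, d0, dc, dv, dL⟩ := h
  refine ⟨contDiff_const.smul hv, hw.const_smul r,
    fun x hx => mul_le_mul_of_nonneg_left (d0 x hx) hr,
    fun x hx y hy => mul_le_mul_of_nonneg_left (dc x hx y hy) hr,
    fun t ht x hx => mul_le_mul_of_nonneg_left (dv t ht x hx) hr, fun t ht x hx => ?_⟩
  rw [lieD_smul f hv]
  exact mul_nonneg hr (dL t ht x hx)

/-- A feasible measure tuple whose cost is the value of the function program. -/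
theorem exists_feasible_integral_eq {n : ℕ} {T : ℝ} (hT : 0 ≤ T) {X X0 Xu : Set (Vec n)}
    (hX : IsCompact X) (hX0 : IsCompact X0) (hXu : IsCompact Xu) (hX0ne : X0.Nonempty)
    (hXune : Xu.Nonempty) (hX0X : X0 ⊆ X) {f : ℝ × Vec n → Vec n}
    (hf : ContinuousOn f (Icc 0 T ×ˢ X)) {c : Vec n × Vec n → ℝ}
    (hc : ContinuousOn c (X ×ˢ Xu)) {d : ℝ}
    (hd : IsLUB {γ | ∃ v w, DualFeasible T X X0 Xu f c γ v w} d) :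
    ∃ μ0 μp μ η, Feasible T X X0 Xu f μ0 μp μ η ∧ ∫ p, c p ∂η = d := by
  have hK : IsCompact (Icc 0 T ×ˢ X) := isCompact_Icc.prod hX
  obtain ⟨x₀, hx₀⟩ := hX0ne
  obtain ⟨y₀, hy₀⟩ := hXune
  obtain ⟨q, -, hq⟩ := (hX.prod hXu).exists_isMinOn ⟨(x₀, y₀), hX0X hx₀, hy₀⟩ hc
  have hdc : d ≤ c (x₀, y₀) := hd.2 fun γ ⟨v, w, h⟩ => h.le_cost hT hX0X hx₀ hy₀
  let φ : (contDiffOneSubmodule n × C(Vec n, ℝ) × ℝ × ℝ) →ₗ[ℝ] ℝ :=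
    { toFun := fun u => u.2.2.2 * d - u.2.2.1
      map_add' := fun a b => by simp; ring
      map_smul' := fun r a => by simp; ring }
  have hφ : ∀ u, 0 ≤ dualConstraint X0 hf hc u → 0 ≤ φ u := by
    intro u hu
    rw [dualConstraint_nonneg_iff] at hu
    change 0 ≤ u.2.2.2 * d - u.2.2.1
    rcases le_or_gt u.2.2.2 0 with hs | hs
    · have h₁ := hu.le_cost hT hX0X hx₀ hy₀
      have h₂ := mul_le_mul_of_nonpos_left hdc hs
      linarith
    · have h := hu.smul (inv_nonneg.mpr hs.le)
      simp only [inv_mul_cancel_left₀ hs.ne'] at h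
      have h' := hd.1 ⟨_, _, h⟩
      rw [inv_mul_le_iff₀ hs] at h'
      linarith
  obtain ⟨Λ, hΛ, hΛB⟩ := exists_nonneg_linearMap_comp_eq (dualConstraint X0 hf hc) φ hφ
    (exists_nonneg_dualConstraint_add hX hX0 hXu hf hc (isMinOn_iff.mp hq))
  obtain ⟨μ0, f0, s0, i0⟩ := exists_measure_integral_eq_of_isCompact hX0
    (Λ ∘ₗ LinearMap.inl ℝ _ _) fun g hg => hΛ _ ⟨hg, le_rfl⟩
  obtain ⟨μp, fp, sp, ip⟩ := exists_measure_integral_eq_of_isCompact hK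
    (Λ ∘ₗ LinearMap.inr ℝ _ _ ∘ₗ LinearMap.inl ℝ _ _) fun g hg => hΛ _ ⟨le_rfl, hg, le_rfl⟩
  obtain ⟨μ, fm, sm, im⟩ := exists_measure_integral_eq_of_isCompact hK
    (Λ ∘ₗ LinearMap.inr ℝ _ _ ∘ₗ LinearMap.inr ℝ _ _ ∘ₗ LinearMap.inl ℝ _ _)
    fun g hg => hΛ _ ⟨le_rfl, le_rfl, hg, le_rfl⟩
  obtain ⟨η, fη, sη, iη⟩ := exists_measure_integral_eq_of_isCompact (hX.prod hXu)
    (Λ ∘ₗ LinearMap.inr ℝ _ _ ∘ₗ LinearMap.inr ℝ _ _ ∘ₗ LinearMap.inr ℝ _ _)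
    fun g hg => hΛ _ ⟨le_rfl, le_rfl, le_rfl, hg⟩
  have key : ∀ (v : ℝ × Vec n → ℝ) (_ : ContDiff ℝ 1 v) (w : Vec n → ℝ) (_ : Continuous w)
      (γ s : ℝ), (∫ x, (v (0, x) - γ) ∂μ0) + (∫ z, (w z.2 - v z) ∂μp) + (∫ z, LieD f v z ∂μ) +
        (∫ p, (s * c p - w p.1) ∂η) = s * d - γ := by
    intro v hv w hw γ s
    have hv0 : Continuous fun x => v (0, x) := hv.continuous.comp (by fun_prop)
    rw [i0 (fun x => v (0, x) - γ) (hv0.sub continuous_const).continuousOn,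
      ip (fun z => w z.2 - v z) ((hw.comp continuous_snd).sub hv.continuous).continuousOn,
      im _ (continuousOn_lieD hf hv),
      iη (fun p => s * c p - w p.1) ((continuousOn_const.mul hc).sub (hw.comp continuous_fst).continuousOn)]
    refine Eq.trans ?_ (hΛB (⟨v, mem_contDiffOneSubmodule.mpr hv⟩, ⟨w, hw⟩, γ, s))
    simp only [LinearMap.comp_apply, ← map_add]
    congr 1
    refine Prod.ext ?_ (Prod.ext ?_ (Prod.ext ?_ ?_)) <;> ext z
    · simp [dualConstraint]
    · simp [dualConstraint]
    · simp only [LinearMap.inl_apply, LinearMap.inr_apply, Prod.fst_add, Prod.snd_add, zero_add,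
        add_zero]
      rfl
    · simp [dualConstraint]
  have hL0 : ∀ z, LieD f (fun _ => 0) z = 0 := fun z => by simp [LieD]
  refine ⟨μ0, μp, μ, η, ⟨f0, fp, fm, fη, s0, sp, sm, sη, ?_, fun v hv => ?_, fun w hw => ?_⟩, ?_⟩
  · have h := key (fun _ => 0) contDiff_const (fun _ => 0) continuous_const (-1) 0
    simp [hL0, measureReal_def] at h
    rwa [ENNReal.toReal_eq_one_iff, ← measure_add_measure_compl hX0.isClosed.measurableSet, s0,
      add_zero] at h
  · have h := key v hv (fun _ => 0) continuous_const 0 0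
    simp [integral_neg] at h
    linarith
  · have h := key (fun _ => 0) contDiff_const w hw 0 0
    simp [hL0, integral_neg] at h
    linarith
  · have h := key (fun _ => 0) contDiff_const (fun _ => 0) continuous_const 0 1
    simpa [hL0] using h

/-- **Theorem 2**: strong duality `p* = d*` between the
distance-estimation measure program and its function program, together with attainment
of the measure-program optimum, under compactness, Lipschitz dynamics, continuity of
the cost, and the non-return assumption A4. -/
theorem strong_duality {n : ℕ} (T : ℝ) (hT : 0 < T)
    (X X0 Xu : Set (Vec n)) (hX : IsCompact X) (hX0 : IsCompact X0) (hXu : IsCompact Xu)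
    (hX0ne : X0.Nonempty) (hXune : Xu.Nonempty) (hX0X : X0 ⊆ X) (hXuX : Xu ⊆ X)
    (f : ℝ × Vec n → Vec n) (K : NNReal) (hf : LipschitzOnWith K f (Icc 0 T ×ˢ X))
    (c : Vec n × Vec n → ℝ) (hc : ContinuousOn c (X ×ˢ Xu))
    (hA4 : ∀ x : ℝ → Vec n, x 0 ∈ X0 →
      (∀ t ∈ Icc (0 : ℝ) T, HasDerivAt x (f (t, x t)) t) →
      ∀ t ∈ Icc (0 : ℝ) T, x t ∈ frontier X → ∀ t' ∈ Ioc t T, x t' ∉ X) :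
    sInf {r | ∃ μ0 μp μ η, Feasible T X X0 Xu f μ0 μp μ η ∧ r = ∫ p, c p ∂η} =
      sSup {γ | ∃ v w, DualFeasible T X X0 Xu f c γ v w} ∧
    ∃ μ0 μp μ η, Feasible T X X0 Xu f μ0 μp μ η ∧
      (∫ p, c p ∂η) =
        sInf {r | ∃ μ0' μp' μ' η', Feasible T X X0 Xu f μ0' μp' μ' η' ∧
          r = ∫ p, c p ∂η'} := by
  have hfc := hf.continuousOn
  obtain ⟨x₀, hx₀⟩ := hX0ne
  obtain ⟨y₀, hy₀⟩ := hXune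
  obtain ⟨q, -, hq⟩ := (hX.prod hXu).exists_isMinOn ⟨(x₀, y₀), hX0X hx₀, hy₀⟩ hc
  rw [isMinOn_iff] at hq
  have hne : {γ | ∃ v w, DualFeasible T X X0 Xu f c γ v w}.Nonempty :=
    ⟨c q, fun _ => c q, fun _ => c q, contDiff_const, continuous_const, fun _ _ => le_rfl,
      fun x hx y hy => hq (x, y) ⟨hx, hy⟩, fun _ _ _ _ => le_rfl,
      fun _ _ _ _ => by simp [LieD]⟩
  have hbdd : BddAbove {γ | ∃ v w, DualFeasible T X X0 Xu f c γ v w} :=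
    ⟨c (x₀, y₀), fun γ ⟨v, w, h⟩ => h.le_cost hT.le hX0X hx₀ hy₀⟩
  obtain ⟨μ0, μp, μ, η, hfeas, hval⟩ := exists_feasible_integral_eq hT.le hX hX0 hXu ⟨x₀, hx₀⟩
    ⟨y₀, hy₀⟩ hX0X hfc hc (isLUB_csSup hne hbdd)
  have hleast : IsLeast {r | ∃ μ0 μp μ η, Feasible T X X0 Xu f μ0 μp μ η ∧ r = ∫ p, c p ∂η}
      (sSup {γ | ∃ v w, DualFeasible T X X0 Xu f c γ v w}) := by
    refine ⟨⟨μ0, μp, μ, η, hfeas, hval.symm⟩, ?_⟩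
    rintro r ⟨μ0', μp', μ', η', h', rfl⟩
    exact csSup_le hne fun γ ⟨v, w, h⟩ => h'.le_integral hX hX0 hXu hc h
  exact ⟨hleast.csInf_eq, μ0, μp, μ, η, hfeas, hval.trans hleast.csInf_eq.symm⟩
end
end

section
/- Polynomial near-optimal certificates (Corollary 1): Fix T > 0, compact sets X ⊆ ℝⁿ, X₀ ⊆ X, X_u ⊆ X, a function f : ℝ × ℝⁿ → ℝⁿ Lipschitz in each argument on [0,T] × X, and a continuous cost c on X × X_u, and assume the non-return property for trajectories starting in X₀. Then for every δ > 0 there exist a real number γ, a polynomial w ∈ ℝ[x], and a polynomial v ∈ ℝ[t,x] such that (γ, v, w) is dual-feasible (the inequalities holding strictly) and P* − δ ≤ γ ≤ P*, where P* is the minimal distance of trajectories to X_u. -/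
open MeasureTheory Set

noncomputable section

/-- A strictly dual-feasible triple `(γ, v, w)`: all four inequalities of the
distance-estimation function program hold strictly. -/
def StrictDualFeasible {n : ℕ} (T : ℝ) (X X0 Xu : Set (Vec n)) (f : ℝ × Vec n → Vec n)
    (c : Vec n × Vec n → ℝ) (γ : ℝ) (v : ℝ × Vec n → ℝ) (w : Vec n → ℝ) : Prop :=
  ContDiff ℝ 1 v ∧ Continuous w ∧
  (∀ x ∈ X0, γ < v (0, x)) ∧
  (∀ x ∈ X, ∀ y ∈ Xu, w x < c (x, y)) ∧
  (∀ t ∈ Icc 0 T, ∀ x ∈ X, v (t, x) < w x) ∧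
  (∀ t ∈ Icc 0 T, ∀ x ∈ X, 0 < LieD f v (t, x))

/-- The minimal distance `P*` of trajectories to the unsafe set. -/
def PStar {n : ℕ} (T : ℝ) (X X0 Xu : Set (Vec n)) (f : ℝ × Vec n → Vec n)
    (c : Vec n × Vec n → ℝ) : ℝ :=
  sInf {r | ∃ (x : ℝ → Vec n) (tp : ℝ) (y : Vec n),
    Admissible T X X0 f x tp ∧ y ∈ Xu ∧ r = c (x tp, y)}

open Metric Filter Topology
open scoped NNReal

/-- The coordinates `(t, x₁, …, xₙ)` of a point of `ℝ × ℝⁿ`. -/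
def coords {n : ℕ} (p : ℝ × Vec n) : Fin (n + 1) → ℝ := Fin.cons p.1 fun i => p.2 i

/-- Polynomial functions on `ℝ × ℝⁿ`. -/
def IsPolyFun {n : ℕ} (g : ℝ × Vec n → ℝ) : Prop :=
  ∃ V : MvPolynomial (Fin (n + 1)) ℝ, ∀ p, g p = MvPolynomial.eval (coords p) V

theorem contDiff_coords {n : ℕ} (i : Fin (n + 1)) :
    ContDiff ℝ 1 fun p : ℝ × Vec n => coords p i := by
  refine Fin.cases ?_ (fun j => ?_) i
  · simpa [coords] using contDiff_fst
  · simp only [coords, Fin.cons_succ]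
    fun_prop

theorem coords_sub {n : ℕ} (p q : ℝ × Vec n) (i : Fin (n + 1)) :
    coords (p - q) i = coords p i - coords q i := by
  refine Fin.cases ?_ (fun j => ?_) i <;> simp [coords]

theorem contDiff_eval_coords {n : ℕ} (V : MvPolynomial (Fin (n + 1)) ℝ) :
    ContDiff ℝ 1 fun p : ℝ × Vec n => MvPolynomial.eval (coords p) V := by
  induction V using MvPolynomial.induction_on with
  | C a => simpa using contDiff_const
  | add P Q hP hQ => simpa using hP.add hQ
  | mul_X P i hP => simpa using hP.mul (contDiff_coords i)

theorem IsPolyFun.contDiff {n : ℕ} {g : ℝ × Vec n → ℝ} (hg : IsPolyFun g) :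
    ContDiff ℝ 1 g := by
  obtain ⟨V, hV⟩ := hg
  rw [funext hV]
  exact contDiff_eval_coords V

theorem HasCompactSupport.integrable_mul_eval_coords {n : ℕ} {g : ℝ × Vec n → ℝ}
    (hg : Continuous g) (hgc : HasCompactSupport g) (V : MvPolynomial (Fin (n + 1)) ℝ)
    (p : ℝ × Vec n) :
    Integrable fun q => g q * MvPolynomial.eval (coords (p - q)) V :=
  (hg.mul ((contDiff_eval_coords V).continuous.comp
    (continuous_const.sub continuous_id))).integrable_of_hasCompactSupport hgc.mul_right

theorem isPolyFun_integral_mul_eval {n : ℕ} (V : MvPolynomial (Fin (n + 1)) ℝ) :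
    ∀ g : ℝ × Vec n → ℝ, Continuous g → HasCompactSupport g →
      IsPolyFun fun p => ∫ q, g q * MvPolynomial.eval (coords (p - q)) V := by
  induction V using MvPolynomial.induction_on with
  | C a =>
    intro g _ _
    exact ⟨MvPolynomial.C (∫ q, g q * a), fun p => by simp⟩
  | add P Q hP hQ =>
    intro g hg hgc
    obtain ⟨A, hA⟩ := hP g hg hgc
    obtain ⟨B, hB⟩ := hQ g hg hgc
    refine ⟨A + B, fun p => ?_⟩
    rw [map_add, ← hA, ← hB, ← integral_add (hgc.integrable_mul_eval_coords hg P p)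
      (hgc.integrable_mul_eval_coords hg Q p)]
    simp [mul_add]
  | mul_X P i hP =>
    intro g hg hgc
    have hg' : Continuous fun q => g q * coords q i := hg.mul (contDiff_coords i).continuous
    have hgc' : HasCompactSupport fun q => g q * coords q i := hgc.mul_right
    obtain ⟨A, hA⟩ := hP g hg hgc
    obtain ⟨B, hB⟩ := hP _ hg' hgc'
    refine ⟨A * MvPolynomial.X i - B, fun p => ?_⟩
    simp only [map_sub, map_mul, MvPolynomial.eval_X, ← hA, ← hB]
    rw [← integral_mul_const, ← integral_sub
      ((hgc.integrable_mul_eval_coords hg P p).mul_const _)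
      (hgc'.integrable_mul_eval_coords hg' P p)]
    congr 1 with q
    rw [coords_sub]
    ring

/-- Nonnegative polynomial approximate identities on a ball (Landau kernels). -/
theorem exists_poly_kernel (n : ℕ) {ε R η : ℝ} (hε : 0 < ε) (hR : ε ≤ R) (hη : 0 < η) :
    ∃ k : ℝ × Vec n → ℝ, IsPolyFun k ∧ (∀ z, 0 ≤ k z) ∧ ∫ z in closedBall 0 ε, k z = 1 ∧
      ∀ z, ε ≤ ‖z‖ → ‖z‖ ≤ R → k z ≤ η := by
  have hR0 : 0 < R := hε.trans_le hR
  set S : ℝ × Vec n → ℝ := fun z => 1 - (z.1 ^ 2 + ‖z.2‖ ^ 2) / (2 * R ^ 2) with hS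
  have hSc : Continuous S := by fun_prop
  have hSlow : ∀ z : ℝ × Vec n, 1 - ‖z‖ ^ 2 / R ^ 2 ≤ S z := by
    intro z
    have h1 : z.1 ^ 2 ≤ ‖z‖ ^ 2 := sq_le_sq' (by
      have := (neg_abs_le z.1); have h2 := norm_fst_le z; rw [Real.norm_eq_abs] at h2; linarith)
      (by have := (le_abs_self z.1); have h2 := norm_fst_le z; rw [Real.norm_eq_abs] at h2; linarith)
    have h2 : ‖z.2‖ ^ 2 ≤ ‖z‖ ^ 2 := by gcongr; exact norm_snd_le z
    have : ‖z‖ ^ 2 / R ^ 2 = (2 * ‖z‖ ^ 2) / (2 * R ^ 2) := by field_simp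
    rw [this]
    simp only [hS]
    gcongr
    linarith
  have hSup : ∀ z : ℝ × Vec n, S z ≤ 1 - ‖z‖ ^ 2 / (2 * R ^ 2) := by
    intro z
    simp only [hS]
    gcongr
    rcases max_choice ‖z.1‖ ‖z.2‖ with h | h <;> rw [Prod.norm_def, h]
    · rw [Real.norm_eq_abs, sq_abs]; nlinarith [sq_nonneg ‖z.2‖]
    · nlinarith [sq_nonneg z.1]
  obtain ⟨V, hV⟩ : IsPolyFun S := by
    refine ⟨1 - MvPolynomial.C (2 * R ^ 2)⁻¹ *
      (MvPolynomial.X 0 ^ 2 + ∑ i : Fin n, MvPolynomial.X i.succ ^ 2), fun p => ?_⟩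
    simp [hS, coords, EuclideanSpace.norm_sq_eq, div_eq_inv_mul]
  set b : ℝ := 1 - (ε / 2) ^ 2 / R ^ 2 with hb
  set a : ℝ := 1 - ε ^ 2 / (2 * R ^ 2) with ha
  have hab : a < b := by
    have : (ε / 2) ^ 2 / R ^ 2 = (ε ^ 2 / 2) / (2 * R ^ 2) := by field_simp
    rw [ha, hb, this]
    have : 0 < ε ^ 2 := by positivity
    gcongr
    linarith
  have ha0 : 0 ≤ a := by
    rw [ha, sub_nonneg, div_le_one (by positivity)]
    nlinarith
  have hb0 : 0 < b := ha0.trans_lt hab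
  set m : ℝ := volume.real (closedBall (0 : ℝ × Vec n) (ε / 2)) with hm
  have hm0 : 0 < m := by
    refine ENNReal.toReal_pos ?_ (measure_closedBall_lt_top).ne
    exact (measure_closedBall_pos _ _ (by positivity)).ne'
  obtain ⟨N, hN⟩ : ∃ N : ℕ, ((a / b) ^ 2) ^ N < η * m := by
    refine exists_pow_lt_of_lt_one (by positivity) ?_
    have : a / b < 1 := (div_lt_one hb0).2 hab
    exact pow_lt_one₀ (by positivity) this (by norm_num)
  set A : ℝ := ∫ z in closedBall (0 : ℝ × Vec n) ε, S z ^ (2 * N) with hA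
  have hint : ∀ r, IntegrableOn (fun z => S z ^ (2 * N)) (closedBall (0 : ℝ × Vec n) r) := fun r =>
    (hSc.pow _).continuousOn.integrableOn_compact (isCompact_closedBall _ _)
  have hnn : ∀ z, 0 ≤ S z ^ (2 * N) := fun z => (even_two_mul N).pow_nonneg _
  have hAlow : m * b ^ (2 * N) ≤ A := by
    calc m * b ^ (2 * N) = ∫ z in closedBall (0 : ℝ × Vec n) (ε / 2), b ^ (2 * N) := by
          simp [hm]
      _ ≤ ∫ z in closedBall (0 : ℝ × Vec n) (ε / 2), S z ^ (2 * N) := by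
          refine setIntegral_mono_on (by simp [measure_closedBall_lt_top]) (hint _)
            measurableSet_closedBall fun z hz => ?_
          rw [mem_closedBall_zero_iff] at hz
          refine pow_le_pow_left₀ hb0.le (le_trans ?_ (hSlow z)) _
          rw [hb]
          gcongr
      _ ≤ A := setIntegral_mono_set (hint _) (Eventually.of_forall hnn)
          (closedBall_subset_closedBall (by linarith)).eventuallyLE
  have hA0 : 0 < A := lt_of_lt_of_le (by positivity) hAlow
  refine ⟨fun z => A⁻¹ * S z ^ (2 * N), ⟨MvPolynomial.C A⁻¹ * V ^ (2 * N), fun p => ?_⟩,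
    fun z => mul_nonneg (inv_nonneg.2 hA0.le) (hnn z), ?_, fun z hz1 hz2 => ?_⟩
  · simp [hV]
  · rw [integral_const_mul, inv_mul_cancel₀ hA0.ne']
  · rw [inv_mul_le_iff₀ hA0]
    have h1 : S z ^ (2 * N) ≤ a ^ (2 * N) := by
      refine pow_le_pow_left₀ (le_trans ?_ (hSlow z)) ((hSup z).trans ?_) _
      · rw [sub_nonneg, div_le_one (by positivity)]
        gcongr
      · rw [ha]; gcongr
    have h2 : a ^ (2 * N) ≤ η * m * b ^ (2 * N) := by
      rw [← pow_mul, div_pow, div_lt_iff₀ (by positivity)] at hN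
      exact hN.le
    calc _ ≤ η * m * b ^ (2 * N) := h1.trans h2
      _ = (m * b ^ (2 * N)) * η := by ring
      _ ≤ A * η := by gcongr

instance {n : ℕ} : (volume : Measure (ℝ × Vec n)).IsAddHaarMeasure :=
  inferInstanceAs ((volume : Measure ℝ).prod (volume : Measure (Vec n))).IsAddHaarMeasure

/-- Simultaneous polynomial approximation of a compactly supported Lipschitz function and of
lower bounds on its directional difference quotients. -/
theorem exists_poly_approx {n : ℕ} {g : ℝ × Vec n → ℝ} {Λ : ℝ≥0} (hg : LipschitzWith Λ g)
    (hgc : HasCompactSupport g) {K : Set (ℝ × Vec n)} (hK : IsCompact K) {σ ε : ℝ} (hσ : 0 < σ)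
    (hε : 0 < ε) (M : ℝ) :
    ∃ P : ℝ × Vec n → ℝ, IsPolyFun P ∧ (∀ p ∈ K, |P p - g p| ≤ σ) ∧
      ∀ p ∈ K, ∀ d, ‖d‖ ≤ M → (∃ h₀ > 0, ∀ q ∈ closedBall p ε, ∀ h ∈ Ioo 0 h₀,
        -(σ * h) ≤ g (q + h • d) - g q) → -(2 * σ) ≤ fderiv ℝ P p d := by
  wlog hεσ : Λ * ε ≤ σ / 2 generalizing ε
  · set ε' := min ε (σ / (2 * (Λ + 1))) with hε'
    have h0 : 0 < ε' := by positivity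
    obtain ⟨P, hP, hP1, hP2⟩ := this h0 (by
      have h1 : ε' ≤ σ / (2 * (Λ + 1)) := min_le_right _ _
      rw [le_div_iff₀ (by positivity)] at h1
      nlinarith)
    refine ⟨P, hP, hP1, fun p hp d hd ⟨h₀, hh₀, H⟩ => hP2 p hp d hd ⟨h₀, hh₀, fun q hq => H q ?_⟩⟩
    exact closedBall_subset_closedBall (min_le_left _ _) hq
  wlog hM : 0 ≤ M generalizing M
  · obtain ⟨P, hP, hP1, -⟩ := this 0 le_rfl
    exact ⟨P, hP, hP1, fun p hp d hd => absurd ((norm_nonneg d).trans hd) hM⟩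
  obtain ⟨r, hr0, hr⟩ : ∃ r, 0 < r ∧ K ∪ tsupport g ⊆ closedBall 0 r := by
    obtain ⟨r, hr⟩ := (hK.union hgc).isBounded.subset_closedBall (0 : ℝ × Vec n)
    exact ⟨max r 1, by positivity, hr.trans (closedBall_subset_closedBall (le_max_left _ _))⟩
  have hzero : ∀ q, r < ‖q‖ → g q = 0 := fun q hq => by
    by_contra h
    have := hr (Or.inr (subset_tsupport g (Function.mem_support.2 h)))
    rw [mem_closedBall_zero_iff] at this
    linarith
  obtain ⟨B, hB⟩ := hgc.exists_bound_of_continuous hg.continuous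
  have hB0 : 0 ≤ B := (norm_nonneg _).trans (hB 0)
  set m : ℝ := volume.real (closedBall (0 : ℝ × Vec n) (r + 1)) with hm
  have hm0 : 0 ≤ m := measureReal_nonneg
  set D : ℝ := Λ * M + B with hD
  have hD0 : 0 ≤ D := by positivity
  set η : ℝ := σ / (2 * (D * m + 1)) with hη
  have hη0 : 0 < η := by positivity
  have hηD : D * η * m ≤ σ / 2 := by
    rw [hη, mul_div_assoc', div_mul_eq_mul_div, div_le_div_iff₀ (by positivity) (by norm_num)]
    nlinarith
  obtain ⟨k, ⟨V, hV⟩, hk0, hk1, hk2⟩ :=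
    exists_poly_kernel n (R := max ε (2 * r + 1)) hε (le_max_left _ _) hη0
  have hkc : Continuous k := by
    rw [funext hV]
    exact (contDiff_eval_coords V).continuous
  -- the two dominating functions
  set b₁ : ℝ × Vec n → ℝ × Vec n → ℝ :=
    fun p q => (closedBall (0 : ℝ × Vec n) ε).indicator k (p - q) with hb₁
  set b₂ : ℝ × Vec n → ℝ := (closedBall (0 : ℝ × Vec n) (r + 1)).indicator fun _ => η with hb₂
  have hind : Integrable ((closedBall (0 : ℝ × Vec n) ε).indicator k) :=
    (integrable_indicator_iff measurableSet_closedBall).2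
      (hkc.continuousOn.integrableOn_compact (isCompact_closedBall _ _))
  have hb₁i : ∀ p, Integrable (b₁ p) := fun p => hind.comp_sub_left p
  have hb₁1 : ∀ p, ∫ q, b₁ p q = 1 := fun p => by
    rw [← hk1, ← integral_indicator measurableSet_closedBall]
    exact integral_sub_left_eq_self ((closedBall (0 : ℝ × Vec n) ε).indicator k) volume p
  have hb₂i : Integrable b₂ := (integrable_indicator_iff measurableSet_closedBall).2
    (integrableOn_const (measure_closedBall_lt_top.ne))
  have hb₂1 : ∫ q, b₂ q = η * m := by
    rw [integral_indicator measurableSet_closedBall]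
    simp [hm, mul_comm]
  have hb₁0 : ∀ p q, 0 ≤ b₁ p q := fun p q => indicator_nonneg (fun z _ => hk0 z) _
  have hb₂0 : ∀ q, 0 ≤ b₂ q := fun q => indicator_nonneg (fun z _ => hη0.le) _
  have hnear : ∀ p q, ‖p - q‖ ≤ ε → b₁ p q = k (p - q) := fun p q h => by
    simp only [hb₁]
    rw [indicator_of_mem (by simpa using h)]
  have hfar : ∀ p q, ¬ ‖p - q‖ ≤ ε → b₁ p q = 0 := fun p q h => by
    simp only [hb₁]
    rw [indicator_of_notMem (by simpa using h)]
  have hkfar : ∀ p ∈ K, ∀ q, ‖q‖ ≤ r + 1 → ¬ ‖p - q‖ ≤ ε → k (p - q) ≤ b₂ q := by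
    intro p hp q hq h
    have hp' : ‖p‖ ≤ r := by simpa using hr (Or.inl hp)
    simp only [hb₂]
    rw [indicator_of_mem (by simpa using hq)]
    refine hk2 _ (not_le.1 h).le (le_trans ?_ (le_max_right _ _))
    linarith [norm_sub_le p q]
  set P : ℝ × Vec n → ℝ := fun p => ∫ q, g q * k (p - q) with hPdef
  have hP : IsPolyFun P := by
    simp only [hPdef, hV]
    exact isPolyFun_integral_mul_eval V g hg.continuous hgc
  have hPint : ∀ p, Integrable fun q => g q * k (p - q) := fun p => by
    simp only [hV]
    exact hgc.integrable_mul_eval_coords hg.continuous V p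
  refine ⟨P, hP, fun p hp => ?_, fun p hp d hd ⟨h₀, hh₀, H⟩ => ?_⟩
  · have h1 : P p - g p = ∫ q, (g q * k (p - q) - g p * b₁ p q) := by
      rw [integral_sub (hPint p) ((hb₁i p).const_mul _), integral_const_mul, hb₁1, mul_one]
    have h2 : ∫ q, (Λ * ε * b₁ p q + B * b₂ q) = Λ * ε + B * (η * m) := by
      rw [integral_add ((hb₁i p).const_mul _) (hb₂i.const_mul _), integral_const_mul,
        integral_const_mul, hb₁1, hb₂1, mul_one]
    rw [h1, ← Real.norm_eq_abs]
    refine (norm_integral_le_of_norm_le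
      (((hb₁i p).const_mul (Λ * ε)).add (hb₂i.const_mul B))
      (Eventually.of_forall fun q => ?_)).trans (h2.le.trans ?_)
    · by_cases hq : ‖p - q‖ ≤ ε
      · rw [hnear p q hq, ← sub_mul, norm_mul, Real.norm_of_nonneg (hk0 _)]
        have h3 : ‖g q - g p‖ ≤ Λ * ε := by
          rw [← dist_eq_norm]
          refine (hg.dist_le_mul q p).trans ?_
          rw [dist_comm, dist_eq_norm]
          gcongr
        have := mul_nonneg hB0 (hb₂0 q)
        have := mul_le_mul_of_nonneg_right h3 (hk0 (p - q))
        simp only [Pi.add_apply, hnear p q hq]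
        linarith
      · simp only [Pi.add_apply, hfar p q hq, mul_zero, sub_zero, zero_add]
        by_cases hq' : ‖q‖ ≤ r + 1
        · rw [norm_mul, Real.norm_of_nonneg (hk0 _)]
          exact mul_le_mul (hB q) (hkfar p hp q hq' hq) (hk0 _) hB0
        · rw [hzero q (by linarith), zero_mul, norm_zero]
          exact mul_nonneg hB0 (hb₂0 q)
    · have : B * (η * m) ≤ D * η * m := by
        rw [mul_assoc]
        gcongr
        rw [hD]
        have : 0 ≤ Λ * M := by positivity
        linarith
      linarith
  · have hdiff : ∀ h ∈ Ioo 0 (min h₀ (M + 1)⁻¹), -(2 * σ) ≤ h⁻¹ • (P (p + h • d) - P p) := by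
      rintro h ⟨hh, hhlt⟩
      have hh1 : h < h₀ := hhlt.trans_le (min_le_left _ _)
      have hh2 : ‖h • d‖ ≤ 1 := by
        have h3 : h < (M + 1)⁻¹ := hhlt.trans_le (min_le_right _ _)
        rw [lt_inv_comm₀ hh (by positivity)] at h3
        rw [norm_smul, Real.norm_of_nonneg hh.le]
        calc h * ‖d‖ ≤ h * h⁻¹ := by gcongr; linarith
          _ = 1 := mul_inv_cancel₀ hh.ne'
      have hshift : P (p + h • d) = ∫ q, g (q + h • d) * k (p - q) := by
        rw [hPdef]
        simp only
        rw [← integral_add_right_eq_self _ (h • d)]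
        congr 1 with q
        rw [add_sub_add_right_eq_sub]
      have hint' : Integrable fun q => g (q + h • d) * k (p - q) := by
        have := (hPint (p + h • d)).comp_add_right (h • d)
        simpa [add_sub_add_right_eq_sub] using this
      have h1 : P (p + h • d) - P p = ∫ q, (g (q + h • d) - g q) * k (p - q) := by
        rw [hshift]
        simp only [hPdef, sub_mul]
        rw [integral_sub hint' (hPint p)]
      have h2 : ∫ q, (-(σ * h) * b₁ p q - Λ * M * h * b₂ q) = -(σ * h) - Λ * M * h * (η * m) := by
        rw [integral_sub ((hb₁i p).const_mul _) (hb₂i.const_mul _), integral_const_mul,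
          integral_const_mul, hb₁1, hb₂1, mul_one]
      have h3 : -(σ * h) - Λ * M * h * (η * m) ≤ P (p + h • d) - P p := by
        rw [h1, ← h2]
        refine integral_mono (((hb₁i p).const_mul _).sub (hb₂i.const_mul _)) ?_ fun q => ?_
        · refine (hint'.sub (hPint p)).congr (Eventually.of_forall fun q => ?_)
          simp [sub_mul]
        by_cases hq : ‖p - q‖ ≤ ε
        · have h4 := H q (by rwa [mem_closedBall, dist_comm, dist_eq_norm]) h ⟨hh, hh1⟩
          have h5 := mul_le_mul_of_nonneg_right h4 (hk0 (p - q))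
          have h6 : 0 ≤ Λ * M * h * b₂ q := mul_nonneg (by positivity) (hb₂0 q)
          simp only [hnear p q hq]
          linarith
        · simp only [hfar p q hq, mul_zero, zero_sub]
          by_cases hq' : ‖q‖ ≤ r + 1
          · have h4 : |g (q + h • d) - g q| ≤ Λ * M * h := by
              rw [← Real.dist_eq]
              refine (hg.dist_le_mul _ _).trans ?_
              rw [dist_self_add_left, norm_smul, Real.norm_of_nonneg hh.le, mul_assoc, mul_comm M]
              gcongr
            have h5 : |g (q + h • d) - g q| * k (p - q) ≤ Λ * M * h * b₂ q :=
              mul_le_mul h4 (hkfar p hp q hq' hq) (hk0 _) (by positivity)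
            have h6 := mul_le_mul_of_nonneg_right (neg_abs_le (g (q + h • d) - g q)) (hk0 (p - q))
            linarith
          · have h4 : r < ‖q + h • d‖ := by
              have := norm_sub_le (q + h • d) (h • d)
              rw [add_sub_cancel_right] at this
              linarith
            rw [hzero q (by linarith), hzero _ h4, sub_zero, zero_mul]
            exact neg_nonpos.2 (mul_nonneg (by positivity) (hb₂0 q))
      have h4 : Λ * M * h * (η * m) ≤ σ * h := by
        have : Λ * M * (η * m) ≤ D * η * m := by
          rw [mul_assoc D]
          gcongr
          linarith
        nlinarith
      rw [smul_eq_mul, inv_mul_eq_div, le_div_iff₀ hh]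
      linarith
    have hline : HasDerivAt (fun h : ℝ => P (p + h • d)) (fderiv ℝ P p d) 0 := by
      have hF : HasFDerivAt P (fderiv ℝ P p) (p + (0 : ℝ) • d) := by
        rw [zero_smul, add_zero]
        exact (hP.contDiff.differentiable (by norm_num) p).hasFDerivAt
      have hl : HasDerivAt (fun h : ℝ => p + h • d) d 0 := by
        simpa using ((hasDerivAt_id (0 : ℝ)).smul_const d).const_add p
      exact hF.comp_hasDerivAt (0 : ℝ) hl
    refine ge_of_tendsto hline.tendsto_slope_zero_right ?_
    filter_upwards [Ioo_mem_nhdsGT (show (0 : ℝ) < min h₀ (M + 1)⁻¹ by positivity)] with h hh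
    simpa using hdiff h hh

theorem LipschitzOnWith.exists_hasCompactSupport_extension {E : Type*} [NormedAddCommGroup E]
    [ProperSpace E] {K : Set E} (hK : IsCompact K) {g : E → ℝ} {Λ : ℝ≥0}
    (hg : LipschitzOnWith Λ g (cthickening 1 K)) :
    ∃ (Λ' : ℝ≥0) (G : E → ℝ), LipschitzWith Λ' G ∧ HasCompactSupport G ∧
      EqOn G g (cthickening 1 K) := by
  rcases K.eq_empty_or_nonempty with rfl | hne
  · exact ⟨0, 0, LipschitzWith.const 0, HasCompactSupport.zero, by simp⟩
  obtain ⟨e, he, hge⟩ := hg.extend_real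
  obtain ⟨B, hB⟩ := (hK.cthickening (r := 1)).exists_bound_of_continuousOn hg.continuousOn
  set A : ℝ := B + 1 with hA
  set m : E → ℝ := fun q => max (A - infDist q K) 0 with hm
  have hml : LipschitzWith 1 m := by
    refine LipschitzWith.max_const ?_ 0
    simpa using (LipschitzWith.const A).sub (lipschitz_infDist_pt K)
  have hml' : LipschitzWith 1 fun q => -m q := hml.neg
  refine ⟨_, fun q => max (-m q) (min (e q) (m q)), hml'.max (he.min hml), ?_, fun q hq => ?_⟩
  · refine HasCompactSupport.intro (hK.cthickening (r := A)) fun q hq => ?_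
    have h0 : m q = 0 := by
      refine max_eq_right (sub_nonpos.2 (not_lt.1 fun h => hq ?_))
      rw [mem_cthickening_iff, ← ENNReal.ofReal_toReal (infEDist_ne_top hne)]
      exact ENNReal.ofReal_le_ofReal h.le
    simp only [h0, neg_zero]
    exact max_eq_left (min_le_right _ _)
  · have h1 : infDist q K ≤ 1 := by
      rw [mem_cthickening_iff] at hq
      simpa [infDist] using ENNReal.toReal_mono ENNReal.ofReal_ne_top hq
    have h2 := hB q hq
    rw [Real.norm_eq_abs, abs_le] at h2
    have h3 : B ≤ m q := le_max_of_le_left (by linarith)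
    simp only [← hge hq]
    rw [min_eq_left (by linarith), max_eq_right (by linarith)]

theorem LipschitzOnWith.exists_bounded_extension {α : Type*} [PseudoMetricSpace α] {n : ℕ}
    {S : Set α} {f : α → Vec n} {K : ℝ≥0} (hf : LipschitzOnWith K f S) {M : ℝ} (hM0 : 0 ≤ M)
    (hM : ∀ p ∈ S, ‖f p‖ ≤ M) :
    ∃ (K' M' : ℝ≥0) (F : α → Vec n), LipschitzWith K' F ∧ (∀ p, ‖F p‖ ≤ M') ∧ EqOn F f S := by
  obtain ⟨g, hg, hgf⟩ :=
    ((PiLp.lipschitzWith_ofLp 2 fun _ : Fin n => ℝ).comp_lipschitzOnWith hf).extend_pi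
  have hle : -M ≤ M := by linarith
  set c : (Fin n → ℝ) → Fin n → ℝ := fun y i => projIcc (-M) M hle (y i) with hc
  have hcl : LipschitzWith 1 c := by
    refine LipschitzWith.of_dist_le_mul fun y z => ?_
    rw [NNReal.coe_one, one_mul, dist_pi_le_iff dist_nonneg]
    intro i
    have := (LipschitzWith.projIcc hle).dist_le_mul (y i) (z i)
    rw [NNReal.coe_one, one_mul] at this
    exact this.trans (dist_le_pi_dist y z i)
  have hcM : ∀ y, ‖c y‖ ≤ M := fun y => by
    rw [pi_norm_le_iff_of_nonneg hM0]
    intro i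
    rw [Real.norm_eq_abs, abs_le]
    exact (projIcc (-M) M hle (y i)).2
  obtain ⟨L, hL⟩ : ∃ L, LipschitzWith L (WithLp.toLp 2 : (Fin n → ℝ) → Vec n) :=
    ⟨_, PiLp.lipschitzWith_toLp 2 fun _ : Fin n => ℝ⟩
  refine ⟨_, L * M.toNNReal, fun p => WithLp.toLp 2 (c (g p)), hL.comp (hcl.comp hg), fun p => ?_,
    fun p hp => ?_⟩
  · have := hL.dist_le_mul (c (g p)) 0
    rw [WithLp.toLp_zero, dist_zero_right, dist_zero_right] at this
    refine this.trans ?_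
    rw [NNReal.coe_mul, Real.coe_toNNReal _ hM0]
    gcongr
    exact hcM _
  · have h1 : c (g p) = WithLp.ofLp (f p) := by
      rw [← hgf hp]
      funext i
      have h2 : ‖f p i‖ ≤ M := (PiLp.norm_apply_le (f p) i).trans (hM p hp)
      rw [Real.norm_eq_abs, abs_le] at h2
      simp only [hc, Function.comp_apply]
      rw [projIcc_of_mem hle h2]
    simp [h1]

theorem LipschitzWith.comp_prodMk_left {E : Type*} [PseudoEMetricSpace E] {F : ℝ × E → E}
    {K : ℝ≥0} (hF : LipschitzWith K F) (t : ℝ) :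
    LipschitzWith K fun x => F (t, x) := by
  simpa [Function.comp_def] using hF.comp (LipschitzWith.prodMk_left t)

section ODE

variable {E : Type*} [NormedAddCommGroup E] [NormedSpace ℝ E]

theorem exists_hasDerivAt_of_lipschitz_of_bounded [CompleteSpace E] {F : ℝ × E → E} {K M : ℝ≥0}
    (hF : LipschitzWith K F) (hM : ∀ p, ‖F p‖ ≤ M) (a b : ℝ) {t₀ : ℝ} (ht₀ : t₀ ∈ Icc a b)
    (x₀ : E) :
    ∃ γ : ℝ → E, γ t₀ = x₀ ∧ ∀ s ∈ Icc a b, HasDerivAt γ (F (s, γ s)) s := by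
  have hmem : t₀ ∈ Icc (a - 1) (b + 1) := ⟨by linarith [ht₀.1], by linarith [ht₀.2]⟩
  have hmax : 0 ≤ max (b + 1 - t₀) (t₀ - (a - 1)) := le_max_of_le_left (by linarith [hmem.2])
  have hPL : IsPicardLindelof (fun s x => F (s, x)) (⟨t₀, hmem⟩ : Icc (a - 1) (b + 1)) x₀
      (M * (max (b + 1 - t₀) (t₀ - (a - 1))).toNNReal) 0 M K :=
    { lipschitzOnWith := fun t _ =>
        (hF.comp_prodMk_left t).lipschitzOnWith
      continuousOn := fun x _ => (hF.continuous.comp (by fun_prop)).continuousOn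
      norm_le := fun t _ x _ => hM _
      mul_max_le := by rw [NNReal.coe_mul, Real.coe_toNNReal _ hmax, NNReal.coe_zero, sub_zero] }
  obtain ⟨γ, h0, h⟩ := hPL.exists_eq_forall_mem_Icc_hasDerivWithinAt₀
  exact ⟨γ, h0, fun s hs => (h s ⟨by linarith [hs.1], by linarith [hs.2]⟩).hasDerivAt
    (Icc_mem_nhds (by linarith [hs.1]) (by linarith [hs.2]))⟩

theorem dist_le_of_hasDerivAt_Icc {F : ℝ × E → E} {K : ℝ≥0} (hF : LipschitzWith K F) {a b : ℝ}
    {γ₁ γ₂ : ℝ → E} (h₁ : ∀ s ∈ Icc a b, HasDerivAt γ₁ (F (s, γ₁ s)) s)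
    (h₂ : ∀ s ∈ Icc a b, HasDerivAt γ₂ (F (s, γ₂ s)) s) {s t : ℝ} (hs : s ∈ Icc a b)
    (ht : t ∈ Icc a b) :
    dist (γ₁ s) (γ₂ s) ≤ Real.exp (K * (b - a)) * dist (γ₁ t) (γ₂ t) := by
  have hFx : ∀ t, LipschitzWith K fun x => F (t, x) := hF.comp_prodMk_left
  rw [mul_comm]
  rcases le_total t s with hts | hst
  · have hsub : Icc t s ⊆ Icc a b := Icc_subset_Icc ht.1 hs.2
    refine (dist_le_of_trajectories_ODE (v := fun s x => F (s, x)) hFx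
      (fun r hr => (h₁ r (hsub hr)).continuousAt.continuousWithinAt)
      (fun r hr => (h₁ r (hsub (Ico_subset_Icc_self hr))).hasDerivWithinAt)
      (fun r hr => (h₂ r (hsub hr)).continuousAt.continuousWithinAt)
      (fun r hr => (h₂ r (hsub (Ico_subset_Icc_self hr))).hasDerivWithinAt)
      le_rfl s (right_mem_Icc.2 hts)).trans ?_
    gcongr
    · exact hs.2
    · exact ht.1
  · have hsub : ∀ r ∈ Icc (-t) (-s), -r ∈ Icc a b := fun r hr =>
      ⟨by linarith [hr.2, hs.1], by linarith [hr.1, ht.2]⟩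
    have hrev : ∀ γ : ℝ → E, (∀ s ∈ Icc a b, HasDerivAt γ (F (s, γ s)) s) →
        ∀ r ∈ Icc (-t) (-s), HasDerivAt (fun r => γ (-r)) (-F (-r, γ (-r))) r := fun γ h r hr => by
      simpa [Function.comp_def] using (h _ (hsub r hr)).scomp r (hasDerivAt_neg r)
    have := dist_le_of_trajectories_ODE (v := fun s x => -F (-s, x)) (fun t => (hFx (-t)).neg)
      (fun r hr => (hrev γ₁ h₁ r hr).continuousAt.continuousWithinAt)
      (fun r hr => (hrev γ₁ h₁ r (Ico_subset_Icc_self hr)).hasDerivWithinAt)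
      (fun r hr => (hrev γ₂ h₂ r hr).continuousAt.continuousWithinAt)
      (fun r hr => (hrev γ₂ h₂ r (Ico_subset_Icc_self hr)).hasDerivWithinAt)
      le_rfl (-s) (right_mem_Icc.2 (by linarith))
    rw [neg_neg, neg_neg] at this
    refine this.trans ?_
    rw [neg_sub_neg]
    gcongr
    · exact ht.2
    · exact hs.1

theorem dist_le_mul_of_hasDerivAt_Icc {F : ℝ × E → E} {M : ℝ≥0} (hM : ∀ p, ‖F p‖ ≤ M) {a b : ℝ}
    {γ : ℝ → E} (h : ∀ s ∈ Icc a b, HasDerivAt γ (F (s, γ s)) s) {s t : ℝ} (hs : s ∈ Icc a b)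
    (ht : t ∈ Icc a b) : dist (γ s) (γ t) ≤ M * |s - t| := by
  rw [dist_eq_norm, ← Real.norm_eq_abs]
  exact (convex_Icc a b).norm_image_sub_le_of_norm_hasDerivWithin_le
    (fun r hr => (h r hr).hasDerivWithinAt) (fun r _ => hM _) ht hs

/-- A bounded Lipschitz time-dependent vector field has a two-parameter flow which is Lipschitz in
the initial condition; `γ q` is the trajectory through `q.2` at time `q.1`. -/
theorem exists_lipschitz_flow [CompleteSpace E] {F : ℝ × E → E} {K M : ℝ≥0}
    (hF : LipschitzWith K F) (hM : ∀ p, ‖F p‖ ≤ M) (a b : ℝ) :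
    ∃ (γ : ℝ × E → ℝ → E) (Λ : ℝ≥0), (∀ q, q.1 ∈ Icc a b → γ q q.1 = q.2) ∧
      (∀ q, q.1 ∈ Icc a b → ∀ s ∈ Icc a b, HasDerivAt (γ q) (F (s, γ q s)) s) ∧
      (∀ q q', q.1 ∈ Icc a b → q'.1 ∈ Icc a b → ∀ s ∈ Icc a b,
        dist (γ q s) (γ q' s) ≤ Λ * dist q q') ∧
      ∀ q, q.1 ∈ Icc a b → ∀ t ∈ Icc a b, ∀ s ∈ Icc a b, γ (t, γ q t) s = γ q s := by
  have hex : ∀ q : ℝ × E, ∃ γ : ℝ → E, q.1 ∈ Icc a b →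
      γ q.1 = q.2 ∧ ∀ s ∈ Icc a b, HasDerivAt γ (F (s, γ s)) s := fun q => by
    by_cases hq : q.1 ∈ Icc a b
    · obtain ⟨γ, hγ⟩ := exists_hasDerivAt_of_lipschitz_of_bounded hF hM a b hq q.2
      exact ⟨γ, fun _ => hγ⟩
    · exact ⟨0, fun h => absurd h hq⟩
  choose γ hγ using hex
  refine ⟨γ, (Real.exp (K * (b - a))).toNNReal * (1 + M), fun q hq => (hγ q hq).1,
    fun q hq => (hγ q hq).2, fun q q' hq hq' s hs => ?_, fun q hq t ht s hs => ?_⟩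
  · refine (dist_le_of_hasDerivAt_Icc hF (hγ q hq).2 (hγ q' hq').2 hs hq).trans ?_
    rw [NNReal.coe_mul, Real.coe_toNNReal _ (Real.exp_pos _).le, mul_assoc]
    refine mul_le_mul_of_nonneg_left ?_ (Real.exp_pos _).le
    have h1 := dist_le_mul_of_hasDerivAt_Icc hM (hγ q' hq').2 hq' hq
    have h2 : |q'.1 - q.1| ≤ dist q q' := by
      rw [← Real.dist_eq, dist_comm q q']
      exact le_max_left _ _
    have h3 : dist q.2 q'.2 ≤ dist q q' := le_max_right _ _
    have h4 : (M : ℝ) * |q'.1 - q.1| ≤ M * dist q q' := by gcongr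
    rw [(hγ q hq).1]
    rw [(hγ q' hq').1] at h1
    have h5 := dist_triangle q.2 q'.2 (γ q' q.1)
    push_cast
    linarith
  · have h := dist_le_of_hasDerivAt_Icc hF (hγ (t, γ q t) ht).2 (hγ q hq).2 hs ht
    have h0 : γ (t, γ q t) t = γ q t := (hγ (t, γ q t) ht).1
    rw [h0, dist_self, mul_zero] at h
    exact dist_le_zero.1 h

/-- Along a bounded Lipschitz vector field `F`, the accumulated cost `J` (initial cost `D₀` plus
running cost `D₁` of the trajectory through a given point) is Lipschitz, and it grows at most
infinitesimally near the zeros of `D₁`. -/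
theorem exists_accumulated_cost [CompleteSpace E] {F : ℝ × E → E} {K M : ℝ≥0}
    (hF : LipschitzWith K F) (hM : ∀ p, ‖F p‖ ≤ M) {a b : ℝ} (h0 : (0 : ℝ) ∈ Icc a b)
    {D₀ D₁ : E → ℝ} (hD₀ : LipschitzWith 1 D₀) (hD₁ : LipschitzWith 1 D₁)
    (hD₁b : ∀ x, ‖D₁ x‖ ≤ 1) :
    ∃ (γ : ℝ × E → ℝ → E) (J : ℝ × E → ℝ) (Λ : ℝ≥0) (C : ℝ),
      LipschitzOnWith Λ J (Icc a b ×ˢ univ) ∧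
      (∀ q, q.1 ∈ Icc a b → γ q q.1 = q.2 ∧ ∀ s ∈ Icc a b, HasDerivAt (γ q) (F (s, γ q s)) s) ∧
      (∀ q, J q = D₀ (γ q 0) + ∫ s in (0 : ℝ)..q.1, D₁ (γ q s)) ∧ 0 ≤ C ∧
      ∀ p ε, D₁ p.2 = 0 → 0 ≤ ε → ∀ q ∈ closedBall p ε, ∀ h, 0 < h → q.1 ∈ Icc a b →
        q.1 + h ∈ Icc a b → J (q + h • (1, F p)) ≤ J q + h * (C * (ε + h)) := by
  obtain ⟨γ, Λ, hγ0, hγ, hγL, hγγ⟩ := exists_lipschitz_flow hF hM a b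
  have hcont : ∀ q, q.1 ∈ Icc a b → ContinuousOn (fun s => D₁ (γ q s)) (Icc a b) := fun q hq =>
    hD₁.continuous.comp_continuousOn fun s hs => (hγ q hq s hs).continuousAt.continuousWithinAt
  have hii : ∀ q, q.1 ∈ Icc a b → ∀ s ∈ Icc a b, ∀ t ∈ Icc a b,
      IntervalIntegrable (fun s => D₁ (γ q s)) volume s t := fun q hq s hs t ht =>
    ((hcont q hq).mono (uIcc_subset_Icc hs ht)).intervalIntegrable
  set J : ℝ × E → ℝ := fun q => D₀ (γ q 0) + ∫ s in (0 : ℝ)..q.1, D₁ (γ q s) with hJ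
  have hJγ : ∀ q, q.1 ∈ Icc a b → ∀ t ∈ Icc a b,
      J (t, γ q t) = J q + ∫ s in q.1..t, D₁ (γ q s) := fun q hq t ht => by
    have h1 : ∫ s in (0 : ℝ)..t, D₁ (γ (t, γ q t) s) = ∫ s in (0 : ℝ)..t, D₁ (γ q s) := by
      refine intervalIntegral.integral_congr fun s hs => ?_
      rw [hγγ q hq t ht s (uIcc_subset_Icc h0 ht hs)]
    simp only [hJ]
    rw [h1, hγγ q hq t ht 0 h0, add_assoc,
      intervalIntegral.integral_add_adjacent_intervals (hii q hq 0 h0 _ hq) (hii q hq _ hq t ht)]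
  have hlen : 0 ≤ b - a := by linarith [h0.1, h0.2]
  have hJL : LipschitzOnWith (Λ + Λ * (b - a).toNNReal + 1) J (Icc a b ×ˢ univ) := by
    refine LipschitzOnWith.of_dist_le_mul fun q hq q' hq' => ?_
    replace hq := hq.1
    replace hq' := hq'.1
    have e1 : dist (D₀ (γ q 0)) (D₀ (γ q' 0)) ≤ Λ * dist q q' := by
      simpa using (hD₀.dist_le_mul _ _).trans
        (mul_le_mul_of_nonneg_left (hγL q q' hq hq' 0 h0) zero_le_one)
    have e2 : dist (∫ s in (0 : ℝ)..q.1, D₁ (γ q s)) (∫ s in (0 : ℝ)..q.1, D₁ (γ q' s)) ≤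
        Λ * dist q q' * (b - a) := by
      rw [dist_eq_norm, ← intervalIntegral.integral_sub (hii q hq 0 h0 _ hq) (hii q' hq' 0 h0 _ hq)]
      refine (intervalIntegral.norm_integral_le_of_norm_le_const (C := Λ * dist q q')
        fun s hs => ?_).trans ?_
      · rw [← dist_eq_norm]
        simpa using (hD₁.dist_le_mul _ _).trans (mul_le_mul_of_nonneg_left
          (hγL q q' hq hq' s (uIcc_subset_Icc h0 hq (uIoc_subset_uIcc hs))) zero_le_one)
      · gcongr
        rw [sub_zero, abs_le]
        constructor <;> linarith [h0.1, h0.2, hq.1, hq.2]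
    have e3 : dist (∫ s in (0 : ℝ)..q.1, D₁ (γ q' s)) (∫ s in (0 : ℝ)..q'.1, D₁ (γ q' s)) ≤
        dist q q' := by
      rw [dist_eq_norm, intervalIntegral.integral_interval_sub_left (hii q' hq' 0 h0 _ hq)
        (hii q' hq' 0 h0 _ hq')]
      refine (intervalIntegral.norm_integral_le_of_norm_le_const (C := 1)
        fun s hs => hD₁b _).trans ?_
      rw [one_mul, ← Real.dist_eq]
      exact le_max_left _ _
    have e4 := (dist_triangle (∫ s in (0 : ℝ)..q.1, D₁ (γ q s)) _ _).trans (add_le_add e2 e3)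
    refine (dist_add_add_le _ _ _ _).trans ((add_le_add e1 e4).trans (le_of_eq ?_))
    push_cast
    rw [Real.coe_toNNReal _ hlen]
    ring
  set Λ' : ℝ≥0 := Λ + Λ * (b - a).toNNReal + 1 with hΛ'
  refine ⟨γ, J, Λ', (Λ' * K + 1) * (1 + M), hJL, fun q hq => ⟨hγ0 q hq, hγ q hq⟩, fun q => rfl,
    by positivity, fun p ε hp hε q hq h hh hq1 hq2 => ?_⟩
  have hsub : Icc q.1 (q.1 + h) ⊆ Icc a b := Icc_subset_Icc hq1.1 hq2.2
  have hle : q.1 ≤ q.1 + h := by linarith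
  rw [mem_closedBall] at hq
  have hd : ∀ s ∈ Icc q.1 (q.1 + h), dist (γ q s) p.2 ≤ ε + M * h := fun s hs => by
    have h1 := dist_le_mul_of_hasDerivAt_Icc hM (hγ q hq1) (hsub hs) hq1
    rw [hγ0 q hq1] at h1
    have h2 : dist q.2 p.2 ≤ ε := (le_max_right _ _).trans hq
    have h3 : |s - q.1| ≤ h := by
      rw [abs_le]
      constructor <;> linarith [hs.1, hs.2]
    have h4 : (M : ℝ) * |s - q.1| ≤ M * h := by gcongr
    linarith [dist_triangle (γ q s) q.2 p.2]
  have hd' : ∀ s ∈ Icc q.1 (q.1 + h), dist (s, γ q s) p ≤ (1 + M) * (ε + h) := fun s hs => by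
    have h1 : dist q.1 p.1 ≤ ε := (le_max_left _ _).trans hq
    have hMε : 0 ≤ (M : ℝ) * ε := by positivity
    have hMh : 0 ≤ (M : ℝ) * h := by positivity
    refine max_le ?_ ((hd s hs).trans (by linarith))
    rw [Real.dist_eq, abs_le] at h1 ⊢
    simp only
    constructor <;> linarith [hs.1, hs.2, h1.1, h1.2]
  have hint : ∫ s in q.1..(q.1 + h), D₁ (γ q s) ≤ h * ((1 + M) * (ε + h)) := by
    refine (le_abs_self _).trans ?_
    rw [← Real.norm_eq_abs]
    refine (intervalIntegral.norm_integral_le_of_norm_le_const (C := (1 + M) * (ε + h))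
        fun s hs => ?_).trans ?_
    · rw [uIoc_of_le hle] at hs
      have h1 := hD₁.dist_le_mul (γ q s) p.2
      rw [hp, dist_zero_right, NNReal.coe_one, one_mul] at h1
      exact h1.trans ((le_max_right _ _).trans (hd' s (Ioc_subset_Icc_self hs)))
    · rw [add_sub_cancel_left, abs_of_pos hh, mul_comm]
  have htaylor : ‖γ q (q.1 + h) - (q.2 + h • F p)‖ ≤ K * ((1 + M) * (ε + h)) * h := by
    have h1 := (convex_Icc q.1 (q.1 + h)).norm_image_sub_le_of_norm_hasDerivWithin_le
      (f := fun s => γ q s - s • F p) (C := K * ((1 + M) * (ε + h)))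
      (fun s hs => (((hγ q hq1 s (hsub hs)).sub
        ((hasDerivAt_id s).smul_const (F p))).hasDerivWithinAt))
      (fun s hs => by
        rw [one_smul, ← dist_eq_norm]
        refine (hF.dist_le_mul _ _).trans ?_
        gcongr
        exact hd' s hs)
      (left_mem_Icc.2 hle) (right_mem_Icc.2 hle)
    rw [hγ0 q hq1, add_sub_cancel_left, Real.norm_of_nonneg hh.le] at h1
    convert h1 using 2
    rw [add_smul]
    abel
  have hstep := hJL.dist_le_mul (q + h • (1, F p)) ⟨by simpa using hq2, trivial⟩
    (q.1 + h, γ q (q.1 + h)) ⟨hq2, trivial⟩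
  have hdist : dist (q + h • ((1 : ℝ), F p)) (q.1 + h, γ q (q.1 + h)) =
      ‖γ q (q.1 + h) - (q.2 + h • F p)‖ := by
    rw [← dist_eq_norm, dist_comm (γ q (q.1 + h)), Prod.dist_eq]
    simp
  rw [hdist, hJγ q hq1 _ hq2, Real.dist_eq] at hstep
  have h2 := (abs_le.1 hstep).2
  have h3 := mul_le_mul_of_nonneg_left htaylor Λ'.coe_nonneg
  linarith

end ODE

theorem exists_mvPolynomial_near {n : ℕ} (m : C(Vec n, ℝ)) {X : Set (Vec n)} (hX : IsCompact X)
    {ε : ℝ} (hε : 0 < ε) :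
    ∃ W : MvPolynomial (Fin n) ℝ, ∀ x ∈ X, |MvPolynomial.eval (fun i => x i) W - m x| < ε := by
  let φ : MvPolynomial (Fin n) ℝ →ₐ[ℝ] C(Vec n, ℝ) :=
    MvPolynomial.aeval fun i => ⟨fun x => x i, by fun_prop⟩
  have hφ : ∀ W x, φ W x = MvPolynomial.eval (fun i => x i) W := fun W x => by
    induction W using MvPolynomial.induction_on with
    | C a => simp [φ, algebraMap_apply]
    | add P Q hP hQ => simp [hP, hQ]
    | mul_X P i hP => simp [hP, φ]
  have hsep : φ.range.SeparatesPoints := fun x y hxy => by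
    obtain ⟨i, hi⟩ : ∃ i, x i ≠ y i := by
      by_contra! h
      exact hxy (PiLp.ext h)
    exact ⟨φ (MvPolynomial.X i), ⟨_, ⟨_, rfl⟩, rfl⟩, by simpa [hφ] using hi⟩
  obtain ⟨g, ⟨W, rfl⟩, hg⟩ :=
    ContinuousMap.exists_mem_subalgebra_near_continuous_of_isCompact_of_separatesPoints hsep m hX hε
  exact ⟨W, fun x hx => by simpa [hφ] using hg x hx⟩

/-- The pointwise minimum over a compact set of a continuous cost, extended to the whole space. -/
theorem exists_continuous_min {n : ℕ} {X Xu : Set (Vec n)} (hX : IsCompact X) (hXu : IsCompact Xu)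
    (hne : Xu.Nonempty) {c : Vec n × Vec n → ℝ} (hc : ContinuousOn c (X ×ˢ Xu)) :
    ∃ m : C(Vec n, ℝ), ∀ x ∈ X, (∀ y ∈ Xu, m x ≤ c (x, y)) ∧ ∃ y ∈ Xu, m x = c (x, y) := by
  obtain ⟨e, he⟩ := ContinuousMap.exists_restrict_eq (hX.prod hXu).isClosed
    ⟨(X ×ˢ Xu).domRestrict c, hc.domRestrict⟩
  have hec : ∀ x ∈ X, ∀ y ∈ Xu, e (x, y) = c (x, y) := fun x hx y hy =>
    DFunLike.congr_fun he (⟨(x, y), hx, hy⟩ : X ×ˢ Xu)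
  have hcont : Continuous fun x => sInf ((fun y => e (x, y)) '' Xu) :=
    hXu.continuous_sInf (f := fun x y => e (x, y)) e.continuous
  refine ⟨⟨_, hcont⟩, fun x hx => ⟨fun y hy => ?_, ?_⟩⟩
  · rw [← hec x hx y hy]
    exact csInf_le (hXu.image (by fun_prop)).bddBelow (mem_image_of_mem _ hy)
  · obtain ⟨y, hy, h⟩ := hXu.exists_sInf_image_eq hne
      (f := fun y => e (x, y)) (by fun_prop : Continuous _).continuousOn
    exact ⟨y, hy, by rw [← hec x hx y hy]; exact h⟩

theorem PStar_le {n : ℕ} {T : ℝ} {X X0 Xu : Set (Vec n)} (hX : IsCompact X) (hXu : IsCompact Xu)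
    {f : ℝ × Vec n → Vec n} {c : Vec n × Vec n → ℝ} (hc : ContinuousOn c (X ×ˢ Xu))
    {x : ℝ → Vec n} {tp : ℝ} (hx : Admissible T X X0 f x tp) {y : Vec n} (hy : y ∈ Xu) :
    PStar T X X0 Xu f c ≤ c (x tp, y) := by
  refine csInf_le (((hX.prod hXu).image_of_continuousOn hc).bddBelow.mono ?_)
    ⟨x, tp, y, hx, hy, rfl⟩
  rintro _ ⟨x, tp, y, hx, hy, rfl⟩
  exact mem_image_of_mem c ⟨hx.2.2.2 tp ⟨hx.1.1, le_rfl⟩, hy⟩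

/-- The distance to `X`, truncated at `1`. -/
def truncDist {E : Type*} [PseudoMetricSpace E] (X : Set E) (x : E) : ℝ := min (infDist x X) 1

theorem lipschitzWith_truncDist {E : Type*} [PseudoMetricSpace E] (X : Set E) :
    LipschitzWith 1 (truncDist X) :=
  (lipschitz_infDist_pt X).min_const 1

theorem truncDist_nonneg {E : Type*} [PseudoMetricSpace E] (X : Set E) (x : E) :
    0 ≤ truncDist X x :=
  le_min infDist_nonneg zero_le_one

theorem truncDist_eq_zero {E : Type*} [PseudoMetricSpace E] {X : Set E} (hX : IsClosed X)
    (hne : X.Nonempty) {x : E} : truncDist X x = 0 ↔ x ∈ X := by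
  rw [hX.mem_iff_infDist_zero hne, truncDist]
  refine ⟨fun h => ?_, fun h => by simp [h]⟩
  rcases min_choice (infDist x X) 1 with h' | h' <;> rw [h'] at h
  · exact h
  · exact absurd h one_ne_zero

theorem cthickening_Icc_prod_subset {E : Type*} [PseudoMetricSpace E] (T : ℝ) {X : Set E}
    (hX : IsCompact X) : cthickening 1 (Icc 0 T ×ˢ X) ⊆ Icc (-1) (T + 1) ×ˢ univ := by
  rw [(isCompact_Icc.prod hX).cthickening_eq_biUnion_closedBall zero_le_one]
  refine iUnion₂_subset fun p hp q hq => ⟨?_, mem_univ _⟩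
  have h := abs_le.1 ((Real.dist_eq _ _).symm.trans_le ((le_max_left _ _).trans hq))
  exact ⟨by linarith [hp.1.1], by linarith [hp.1.2]⟩

/-- A Lipschitz function which vanishes on the initial set, is positive away from the points
reached by trajectories staying in `X`, and is almost nonincreasing along `f` near `X`. -/
theorem exists_barrier {n : ℕ} {T : ℝ} (hT : 0 < T) {X X0 : Set (Vec n)} (hX : IsCompact X)
    (hX0 : IsCompact X0) (hX0X : X0 ⊆ X) (hne : X0.Nonempty) {f : ℝ × Vec n → Vec n} {K : ℝ≥0}
    (hf : LipschitzOnWith K f (Icc 0 T ×ˢ X)) :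
    ∃ (J : ℝ × Vec n → ℝ) (Λ : ℝ≥0) (C : ℝ),
      LipschitzOnWith Λ J (Icc (-1) (T + 1) ×ˢ univ) ∧ (∀ x ∈ X0, J (0, x) = 0) ∧
      (∀ t ∈ Icc 0 T, ∀ x, 0 ≤ J (t, x)) ∧
      (∀ t ∈ Icc 0 T, ∀ x, J (t, x) = 0 → ∃ γ, Admissible T X X0 f γ t ∧ γ t = x) ∧ 0 ≤ C ∧
      ∀ p ∈ Icc 0 T ×ˢ X, ∀ ε, 0 ≤ ε → ∀ q ∈ closedBall p ε, ∀ h, 0 < h →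
        q.1 ∈ Icc (-1) (T + 1) → q.1 + h ∈ Icc (-1) (T + 1) →
        J (q + h • (1, f p)) ≤ J q + h * (C * (ε + h)) := by
  obtain ⟨B, hB⟩ := (isCompact_Icc.prod hX).exists_bound_of_continuousOn hf.continuousOn
  obtain ⟨K', M', F, hF, hFM, hFf⟩ := hf.exists_bounded_extension (le_max_right B 0)
    fun p hp => (hB p hp).trans (le_max_left _ _)
  have hzero : ∀ {x}, truncDist X x = 0 ↔ x ∈ X :=
    truncDist_eq_zero hX.isClosed (hne.mono hX0X)
  have hzero0 : ∀ {x}, truncDist X0 x = 0 ↔ x ∈ X0 := truncDist_eq_zero hX0.isClosed hne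
  obtain ⟨γ, J, Λ, C, hJL, hγ, hJ, hC, hstep⟩ := exists_accumulated_cost hF hFM
    (⟨by linarith, by linarith⟩ : (0 : ℝ) ∈ Icc (-1) (T + 1)) (lipschitzWith_truncDist X0)
    (lipschitzWith_truncDist X) fun x => by
      rw [Real.norm_of_nonneg (truncDist_nonneg X x)]
      exact min_le_right _ _
  have hsub : Icc 0 T ⊆ Icc (-1) (T + 1) := Icc_subset_Icc (by linarith) (by linarith)
  have hint : ∀ t ∈ Icc 0 T, ∀ x, 0 ≤ ∫ s in (0 : ℝ)..t, truncDist X (γ (t, x) s) :=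
    fun t ht x => intervalIntegral.integral_nonneg ht.1 fun s _ => truncDist_nonneg _ _
  refine ⟨J, Λ, C, hJL, fun x hx => ?_, fun t ht x => ?_, fun t ht x h => ?_, hC,
    fun p hp ε hε q hq h hh h1 h2 => ?_⟩
  · rw [hJ, (hγ (0, x) (hsub ⟨le_rfl, hT.le⟩)).1]
    simpa using hzero0.2 hx
  · rw [hJ]
    exact add_nonneg (truncDist_nonneg _ _) (hint t ht x)
  · obtain ⟨hγt, hγd⟩ := hγ (t, x) (hsub ht)
    rw [hJ, add_eq_zero_iff_of_nonneg (truncDist_nonneg _ _) (hint t ht x), hzero0] at h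
    have hst : ∀ s ∈ Icc 0 t, s ∈ Icc 0 T := fun s hs => ⟨hs.1, hs.2.trans ht.2⟩
    have hmem : ∀ s ∈ Icc 0 t, γ (t, x) s ∈ X := by
      rcases ht.1.eq_or_lt with rfl | hlt
      · intro s hs
        rw [Icc_self, mem_singleton_iff] at hs
        rw [hs]
        exact hX0X h.1
      by_contra! hcon
      obtain ⟨s, hs, hsX⟩ := hcon
      refine (intervalIntegral.integral_pos hlt ?_ (fun s _ => truncDist_nonneg _ _)
        ⟨s, hs, (truncDist_nonneg _ _).lt_of_ne' (mt hzero.1 hsX)⟩).ne' h.2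
      exact (lipschitzWith_truncDist X).continuous.comp_continuousOn fun s hs =>
        (hγd s (hsub (hst s hs))).continuousAt.continuousWithinAt
    refine ⟨γ (t, x), ⟨ht, h.1, fun s hs => ?_, hmem⟩, hγt⟩
    rw [← hFf ⟨hst s hs, hmem s hs⟩]
    exact hγd s (hsub (hst s hs))
  · rw [← hFf hp]
    exact hstep p ε (hzero.2 hp.2) hε q hq h hh h1 h2

/-- A barrier function together with polynomial approximations of its opposite which are
almost nondecreasing along `f`. -/
theorem exists_polynomial_barrier {n : ℕ} {T : ℝ} (hT : 0 < T) {X X0 : Set (Vec n)}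
    (hX : IsCompact X) (hX0 : IsCompact X0) (hX0X : X0 ⊆ X) (hne : X0.Nonempty)
    {f : ℝ × Vec n → Vec n} {K : ℝ≥0} (hf : LipschitzOnWith K f (Icc 0 T ×ˢ X)) :
    ∃ J : ℝ × Vec n → ℝ, ContinuousOn J (Icc 0 T ×ˢ X) ∧ (∀ x ∈ X0, J (0, x) = 0) ∧
      (∀ t ∈ Icc 0 T, ∀ x, 0 ≤ J (t, x)) ∧
      (∀ t ∈ Icc 0 T, ∀ x, J (t, x) = 0 → ∃ γ, Admissible T X X0 f γ t ∧ γ t = x) ∧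
      ∀ σ, 0 < σ → ∃ P, IsPolyFun P ∧ ∀ p ∈ Icc 0 T ×ˢ X,
        |P p + J p| ≤ σ ∧ -(2 * σ) ≤ LieD f P p := by
  obtain ⟨J, Λ, C, hJL, hJ0, hJpos, hJadm, hC, hstep⟩ := exists_barrier hT hX hX0 hX0X hne hf
  have hK : IsCompact (Icc 0 T ×ˢ X) := isCompact_Icc.prod hX
  have hsub := cthickening_Icc_prod_subset T hX
  have hKsub : Icc 0 T ×ˢ X ⊆ cthickening 1 (Icc 0 T ×ˢ X) := self_subset_cthickening _
  refine ⟨J, hJL.continuousOn.mono (hKsub.trans hsub), hJ0, hJpos, hJadm, fun σ hσ => ?_⟩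
  obtain ⟨B, hB⟩ := hK.exists_bound_of_continuousOn hf.continuousOn
  obtain ⟨Λ', G, hG, hGc, hGJ⟩ :=
    LipschitzOnWith.exists_hasCompactSupport_extension hK (hJL.mono hsub).neg
  set ε := min (1 / 2) (σ / (2 * (C + 1))) with hε
  have hε0 : 0 < ε := by positivity
  have hε1 : ε ≤ 1 / 2 := min_le_left _ _
  have hCε : C * ε ≤ σ / 2 := by
    have h1 : ε ≤ σ / (2 * (C + 1)) := min_le_right _ _
    rw [le_div_iff₀ (by positivity)] at h1
    nlinarith
  obtain ⟨P, hP, hPG, hPd⟩ := exists_poly_approx hG hGc hK hσ hε0 (max 1 B)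
  refine ⟨P, hP, fun p hp => ⟨?_, hPd p hp _ ?_ ?_⟩⟩
  · simpa [hGJ (hKsub hp)] using hPG p hp
  · exact (Prod.norm_def _).trans_le (max_le_max (by simp) (hB p hp))
  · set d : ℝ × Vec n := (1, f p) with hd
    have hball : closedBall p 1 ⊆ cthickening 1 (Icc 0 T ×ˢ X) := closedBall_subset_cthickening hp 1
    refine ⟨min ε (1 / (2 * (‖d‖ + 1))), by positivity, fun q hq h hh => ?_⟩
    have hh1 : h ≤ ε := hh.2.le.trans (min_le_left _ _)
    have hh2 : h * ‖d‖ ≤ 1 / 2 := by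
      have h1 := hh.2.le.trans (min_le_right _ _)
      rw [le_div_iff₀ (by positivity)] at h1
      nlinarith [hh.1]
    have hq1 : q ∈ cthickening 1 (Icc 0 T ×ˢ X) :=
      hball (closedBall_subset_closedBall (by linarith) hq)
    have hq2 : q + h • d ∈ cthickening 1 (Icc 0 T ×ˢ X) := by
      refine hball ?_
      rw [mem_closedBall, dist_eq_norm] at hq ⊢
      calc ‖q + h • d - p‖ = ‖(q - p) + h • d‖ := by congr 1; abel
        _ ≤ ‖q - p‖ + h * ‖d‖ := by
          grw [norm_add_le, norm_smul, Real.norm_of_nonneg hh.1.le]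
        _ ≤ 1 := by linarith
    have hq3 := (hsub hq2).1
    have := hstep p hp ε hε0.le q hq h hh.1 (hsub hq1).1 (by simpa [hd] using hq3)
    rw [hGJ hq1, hGJ hq2]
    have h3 : h * (C * (ε + h)) ≤ h * σ := by
      refine mul_le_mul_of_nonneg_left ?_ hh.1.le
      nlinarith
    simp only [Pi.neg_apply]
    linarith

theorem IsCompact.exists_pos_neg_mul_le {α : Type*} [TopologicalSpace α] {K : Set α}
    (hK : IsCompact K) (hKc : IsClosed K) {J h : α → ℝ} (hJ : ContinuousOn J K)
    (hh : ContinuousOn h K) (hJ0 : ∀ p ∈ K, 0 ≤ J p) (hpos : ∀ p ∈ K, J p = 0 → 0 < h p) :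
    ∃ k > 0, ∀ p ∈ K, -(k * J p) ≤ h p := by
  have hS : IsCompact (K ∩ h ⁻¹' Iic 0) :=
    hK.of_isClosed_subset (hh.preimage_isClosed_of_isClosed hKc isClosed_Iic) inter_subset_left
  have hJS : ∀ p ∈ K ∩ h ⁻¹' Iic 0, 0 < J p := fun p hp =>
    (hJ0 p hp.1).lt_of_ne' fun h0 => (hpos p hp.1 h0).not_ge hp.2
  obtain ⟨B, hB⟩ := hS.exists_bound_of_continuousOn (f := fun p => h p / J p)
    ((hh.mono inter_subset_left).div (hJ.mono inter_subset_left) fun p hp => (hJS p hp).ne')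
  refine ⟨max B 1, by positivity, fun p hp => ?_⟩
  rcases le_total (h p) 0 with hle | hge
  · have h1 := (abs_le.1 ((hB p ⟨hp, hle⟩).trans (le_max_left B 1))).1
    rwa [le_div_iff₀ (hJS p ⟨hp, hle⟩), neg_mul] at h1
  · exact (neg_nonpos.2 (mul_nonneg (by positivity) (hJ0 p hp))).trans hge

theorem lieD_affine {n : ℕ} (f : ℝ × Vec n → Vec n) {P : ℝ × Vec n → ℝ} (hP : IsPolyFun P)
    (a k l : ℝ) (p : ℝ × Vec n) :
    LieD f (fun q => a + k * P q + l * q.1) p = k * LieD f P p + l := by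
  have h1 : HasFDerivAt P (fderiv ℝ P p) p :=
    (hP.contDiff.differentiable one_ne_zero p).hasFDerivAt
  have h2 := ((h1.const_mul k).const_add a).add
    ((hasFDerivAt_fst (𝕜 := ℝ) (p := p)).const_mul l)
  rw [LieD, show fderiv ℝ (fun q : ℝ × Vec n => a + k * P q + l * q.1) p = _ from h2.fderiv]
  simp [LieD]

theorem IsPolyFun.affine {n : ℕ} {P : ℝ × Vec n → ℝ} (hP : IsPolyFun P) (a k l : ℝ) :
    IsPolyFun fun q => a + k * P q + l * q.1 := by
  obtain ⟨V, hV⟩ := hP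
  exact ⟨.C a + .C k * V + .C l * .X 0, fun p => by simp [hV, coords]⟩

theorem continuous_eval_coe {n : ℕ} (W : MvPolynomial (Fin n) ℝ) :
    Continuous fun x : Vec n => MvPolynomial.eval (fun i => x i) W :=
  W.continuous_eval.comp (by fun_prop)

/-- The time function gives a certificate as soon as a constant separates the initial bound from
the cost. -/
theorem strictDualFeasible_time {n : ℕ} {T : ℝ} {X X0 Xu : Set (Vec n)} (f : ℝ × Vec n → Vec n)
    {c : Vec n × Vec n → ℝ} {γ A : ℝ} (hA0 : ∀ x ∈ X0, γ < A)
    (hAc : ∀ x ∈ X, ∀ y ∈ Xu, A + T + 1 < c (x, y)) :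
    StrictDualFeasible T X X0 Xu f c γ (fun q => A + 0 * 0 + 1 * q.1) fun _ => A + T + 1 := by
  have h0 : IsPolyFun (n := n) fun _ => 0 := ⟨0, fun p => by simp⟩
  refine ⟨(h0.affine A 0 1).contDiff, continuous_const, by simpa using hA0, hAc,
    fun t ht x _ => by simp only; linarith [ht.2], fun t _ x _ => ?_⟩
  rw [lieD_affine f h0 A 0 1]
  simp

/-- **Corollary 1**: polynomial near-optimal certificates.  For every
`δ > 0` there are a real `γ`, a polynomial `w ∈ ℝ[x]` and a polynomial `v ∈ ℝ[t,x]`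
forming a dual-feasible triple with strict inequalities, and `P* − δ ≤ γ ≤ P*`. -/
theorem polynomial_certificates {n : ℕ} (T : ℝ) (hT : 0 < T)
    (X X0 Xu : Set (Vec n)) (hX : IsCompact X) (hX0 : IsCompact X0) (hXu : IsCompact Xu)
    (hX0X : X0 ⊆ X) (hXuX : Xu ⊆ X)
    (f : ℝ × Vec n → Vec n) (K : NNReal) (hf : LipschitzOnWith K f (Icc 0 T ×ˢ X))
    (c : Vec n × Vec n → ℝ) (hc : ContinuousOn c (X ×ˢ Xu))
    (hA4 : ∀ x : ℝ → Vec n, x 0 ∈ X0 →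
      (∀ t ∈ Icc (0 : ℝ) T, HasDerivAt x (f (t, x t)) t) →
      ∀ t ∈ Icc (0 : ℝ) T, x t ∈ frontier X → ∀ t' ∈ Ioc t T, x t' ∉ X)
    (δ : ℝ) (hδ : 0 < δ) :
    ∃ (γ : ℝ) (w : Vec n → ℝ) (v : ℝ × Vec n → ℝ),
      (∃ W : MvPolynomial (Fin n) ℝ, ∀ x : Vec n,
        w x = MvPolynomial.eval (fun i => x i) W) ∧
      (∃ V : MvPolynomial (Fin (n + 1)) ℝ, ∀ (t : ℝ) (x : Vec n),
        v (t, x) = MvPolynomial.eval (Fin.cons t fun i => x i) V) ∧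
      StrictDualFeasible T X X0 Xu f c γ v w ∧
      PStar T X X0 Xu f c - δ ≤ γ ∧ γ ≤ PStar T X X0 Xu f c := by
  set P' := PStar T X X0 Xu f c with hP'
  rcases em (X0.Nonempty ∧ Xu.Nonempty) with ⟨hne, hneu⟩ | hempty
  · obtain ⟨m, hm⟩ := exists_continuous_min hX hXu hneu hc
    obtain ⟨J, hJ, hJ0, hJpos, hJadm, hJP⟩ := exists_polynomial_barrier hT hX hX0 hX0X hne hf
    have hK : IsCompact (Icc 0 T ×ˢ X) := isCompact_Icc.prod hX
    obtain ⟨k, hk, hkJ⟩ := hK.exists_pos_neg_mul_le hK.isClosed hJ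
      (h := fun p => m p.2 - δ / 4 - (P' - δ / 2)) (by fun_prop)
      (fun p hp => hJpos p.1 hp.1 p.2) fun p hp h => by
        obtain ⟨γ, hγ, hγx⟩ := hJadm p.1 hp.1 p.2 h
        obtain ⟨y, hy, hmy⟩ := (hm p.2 hp.2).2
        have hle := PStar_le hX hXu hc hγ hy
        rw [hγx, ← hmy] at hle
        linarith
    set σ := δ / 32 / (k * (1 + 3 * T)) with hσ
    have hσ0 : 0 < σ := by positivity
    have hkσ : k * σ + 3 * (k * σ) * T = δ / 32 := by
      rw [hσ]
      field_simp
    have hkσ0 : 0 < k * σ := by positivity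
    have hkσT : 0 < 3 * (k * σ) * T := by positivity
    obtain ⟨P, hP, hPJ⟩ := hJP σ hσ0
    obtain ⟨W, hW⟩ := exists_mvPolynomial_near (m - ContinuousMap.const _ (δ / 8)) hX
      (by positivity : 0 < δ / 16)
    have hkP : ∀ p ∈ Icc 0 T ×ˢ X, |k * P p + k * J p| ≤ k * σ := fun p hp => by
      rw [← mul_add, abs_mul, abs_of_pos hk]
      exact mul_le_mul_of_nonneg_left (hPJ p hp).1 hk.le
    have hv := hP.affine (P' - δ / 2) k (3 * (k * σ))
    refine ⟨P' - δ, _, _, ⟨W, fun _ => rfl⟩, hv.imp fun V hV t x => hV (t, x),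
      ⟨hv.contDiff, continuous_eval_coe W, fun x hx => ?_, fun x hx y hy => ?_,
        fun t ht x hx => ?_, fun t ht x hx => ?_⟩, le_rfl, by linarith⟩
    · have h1 := abs_le.1 (hkP (0, x) ⟨⟨le_rfl, hT.le⟩, hX0X hx⟩)
      rw [hJ0 x hx] at h1
      simp only
      linarith
    · have h1 := abs_lt.1 (hW x hx)
      have h2 := (hm x hx).1 y hy
      simp only [ContinuousMap.sub_apply, ContinuousMap.const_apply] at h1
      linarith
    · have h1 := abs_lt.1 (hW x hx)
      have h2 := abs_le.1 (hkP (t, x) ⟨ht, hx⟩)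
      have h3 := hkJ (t, x) ⟨ht, hx⟩
      have h4 : 3 * (k * σ) * t ≤ 3 * (k * σ) * T := by gcongr; exact ht.2
      simp only [ContinuousMap.sub_apply, ContinuousMap.const_apply] at h1 h3 ⊢
      linarith
    · rw [lieD_affine f hP]
      have h1 := mul_le_mul_of_nonneg_left (hPJ (t, x) ⟨ht, hx⟩).2 hk.le
      linarith
  · obtain ⟨A, hA0, hAc⟩ : ∃ A, (∀ x ∈ X0, P' - δ < A) ∧
        ∀ x ∈ X, ∀ y ∈ Xu, A + T + 1 < c (x, y) := by
      rcases Xu.eq_empty_or_nonempty with rfl | hneu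
      · exact ⟨P', fun _ _ => by linarith, by simp⟩
      obtain ⟨L, hL⟩ := ((hX.prod hXu).image_of_continuousOn hc).bddBelow
      refine ⟨L - T - 2, fun x hx => absurd ⟨⟨x, hx⟩, hneu⟩ hempty, fun x hx y hy => ?_⟩
      linarith [hL (mem_image_of_mem c (⟨hx, hy⟩ : (x, y) ∈ X ×ˢ Xu))]
    exact ⟨P' - δ, _, _, ⟨.C (A + T + 1), fun _ => by simp⟩,
      ⟨.C A + .X 0, fun t x => by simp⟩, strictDualFeasible_time f hA0 hAc, le_rfl, by linarith⟩
end
end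

section
/- Shape measure-program lower bound (Theorem 4): Fix T > 0, compact sets Ω ⊆ ℝ^{N_ω}, Ω₀ ⊆ Ω, S ⊆ ℝ^{N_s}, X ⊆ ℝⁿ, X_u ⊆ X, a continuous coordinate-transformation map A : S × Ω → X, a function f : ℝ × ℝ^{N_ω} → ℝ^{N_ω} Lipschitz in each argument, and a continuous cost c on X × X_u. Let P* be the infimum of c(A(s; ω(t_p | ω₀)), y) over all t_p ∈ [0,T], ω₀ ∈ Ω₀, s ∈ S, y ∈ X_u, where ω(· | ω₀) solves ω̇ = f(t, ω) with ω(0) = ω₀. Let p* be the infimum of ∫ c(x,y) dη over all shape-feasible measure tuples (μ₀, μ_p, μ, μ_s, η). Then p* ≤ P*: for every trajectory tuple (y, s, ω₀, t_p), the measures μ₀ = δ_{ω₀}, μ_p = δ_{t_p} ⊗ δ_{ω_p}, η = δ_{A(s; ω_p)} ⊗ δ_y, μ_s = δ_s ⊗ δ_{ω_p} with ω_p = ω(t_p | ω₀), together with the occupation measure μ of t ↦ (t, ω(t | ω₀)) on [0, t_p], are shape-feasible and have objective value c(A(s; ω_p), y). -/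
open MeasureTheory Set

noncomputable section

/-- A shape-feasible measure tuple `(μ₀, μ_p, μ, μ_s, η)` for the shape
distance-estimation measure program: finite nonnegative Borel measures supported on
`Ω₀`, `[0,T] × Ω`, `[0,T] × Ω`, `S × Ω` and `X × X_u` respectively, with `μ₀` a
probability measure, satisfying Liouville's equation, the `ω`-marginal matching
between `μ_p` and `μ_s`, and the matching of the `x`-marginal of `η` with the
pushforward of `μ_s` under `A`. -/
def ShapeFeasible {nw ns n : ℕ} (T : ℝ) (Om Om0 : Set (Vec nw)) (S : Set (Vec ns))
    (X Xu : Set (Vec n)) (A : Vec ns × Vec nw → Vec n) (f : ℝ × Vec nw → Vec nw)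
    (μ0 : Measure (Vec nw)) (μp μ : Measure (ℝ × Vec nw))
    (μs : Measure (Vec ns × Vec nw)) (η : Measure (Vec n × Vec n)) : Prop :=
  IsFiniteMeasure μ0 ∧ IsFiniteMeasure μp ∧ IsFiniteMeasure μ ∧
  IsFiniteMeasure μs ∧ IsFiniteMeasure η ∧
  μ0 Om0ᶜ = 0 ∧ μp ((Icc 0 T ×ˢ Om)ᶜ) = 0 ∧ μ ((Icc 0 T ×ˢ Om)ᶜ) = 0 ∧
  μs ((S ×ˢ Om)ᶜ) = 0 ∧ η ((X ×ˢ Xu)ᶜ) = 0 ∧ μ0 Om0 = 1 ∧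
  (∀ v : ℝ × Vec nw → ℝ, ContDiff ℝ 1 v →
    (∫ z, v z ∂μp) = (∫ w, v (0, w) ∂μ0) + ∫ z, LieD f v z ∂μ) ∧
  (∀ z : Vec nw → ℝ, Continuous z → (∫ p, z p.2 ∂μp) = ∫ q, z q.2 ∂μs) ∧
  (∀ w : Vec n → ℝ, Continuous w → (∫ p, w p.1 ∂η) = ∫ q, w (A q) ∂μs)

/-- An admissible orientation trajectory: `t_p ∈ [0,T]`, `ω(0) ∈ Ω₀`, `ω` solves
`ω̇ = f(t,ω)` on `[0, t_p]` and remains in `Ω` there. -/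
def ShapeAdmissible {nw : ℕ} (T : ℝ) (Om Om0 : Set (Vec nw)) (f : ℝ × Vec nw → Vec nw)
    (w : ℝ → Vec nw) (tp : ℝ) : Prop :=
  tp ∈ Icc 0 T ∧ w 0 ∈ Om0 ∧ (∀ t ∈ Icc 0 tp, HasDerivAt w (f (t, w t)) t) ∧
  ∀ t ∈ Icc 0 tp, w t ∈ Om

/-- The occupation measure of a trajectory solves Liouville's equation between its end points. -/
theorem integral_lieD_occupation {nw : ℕ} {tp : ℝ} (htp : 0 ≤ tp)
    {f : ℝ × Vec nw → Vec nw} (hf : Continuous f) {w : ℝ → Vec nw}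
    (hw : ∀ t ∈ Icc 0 tp, HasDerivAt w (f (t, w t)) t)
    {v : ℝ × Vec nw → ℝ} (hv : ContDiff ℝ 1 v) :
    ∫ z, LieD f v z ∂(Measure.map (fun t => (t, w t)) (volume.restrict (Icc 0 tp))) =
      v (tp, w tp) - v (0, w 0) := by
  have hcont : ContinuousOn (fun t => (t, w t)) (Icc 0 tp) :=
    continuousOn_id.prodMk fun t ht => (hw t ht).continuousAt.continuousWithinAt
  have hL : Continuous (LieD f v) :=
    (hv.continuous_fderiv one_ne_zero).clm_apply (continuous_const.prodMk hf)
  rw [integral_map (hcont.aemeasurable measurableSet_Icc) hL.aestronglyMeasurable,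
    integral_Icc_eq_integral_Ioc, ← intervalIntegral.integral_of_le htp]
  refine intervalIntegral.integral_eq_sub_of_hasDerivAt (f := fun t => v (t, w t)) ?_ ?_
  · intro t ht
    rw [uIcc_of_le htp] at ht
    exact (hv.differentiable one_ne_zero (t, w t)).hasFDerivAt.comp_hasDerivAt t
      ((hasDerivAt_id t).prodMk (hw t ht))
  · refine ContinuousOn.intervalIntegrable ?_
    rw [uIcc_of_le htp]
    exact hL.comp_continuousOn hcont

/-- A trajectory tuple yields a shape-feasible measure tuple. -/
theorem shapeFeasible_of_shapeAdmissible {nw ns n : ℕ} {T : ℝ}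
    {Om Om0 : Set (Vec nw)} {S : Set (Vec ns)} {X Xu : Set (Vec n)}
    (hOm : MeasurableSet Om) (hOm0 : MeasurableSet Om0) (hS : MeasurableSet S)
    (hX : MeasurableSet X) (hXu : MeasurableSet Xu)
    {A : Vec ns × Vec nw → Vec n} (hmaps : ∀ s ∈ S, ∀ w ∈ Om, A (s, w) ∈ X)
    {f : ℝ × Vec nw → Vec nw} (hf : Continuous f) {w : ℝ → Vec nw} {tp : ℝ}
    {s : Vec ns} {y : Vec n} (h : ShapeAdmissible T Om Om0 f w tp) (hs : s ∈ S) (hy : y ∈ Xu) :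
    ShapeFeasible T Om Om0 S X Xu A f (Measure.dirac (w 0))
      (Measure.dirac (tp, w tp))
      (Measure.map (fun t => (t, w t)) (volume.restrict (Icc 0 tp)))
      ((Measure.dirac s).prod (Measure.dirac (w tp)))
      ((Measure.dirac (A (s, w tp))).prod (Measure.dirac y)) := by
  obtain ⟨htp, hw0, hw, hwOm⟩ := h
  have hend : tp ∈ Icc 0 tp := right_mem_Icc.2 htp.1
  have hcont : ContinuousOn (fun t => (t, w t)) (Icc 0 tp) :=
    continuousOn_id.prodMk fun t ht => (hw t ht).continuousAt.continuousWithinAt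
  have hae : AEMeasurable (fun t => (t, w t)) (volume.restrict (Icc 0 tp)) :=
    hcont.aemeasurable measurableSet_Icc
  refine ⟨inferInstance, inferInstance, inferInstance, inferInstance, inferInstance,
    ?_, ?_, ?_, ?_, ?_, ?_, ?_, ?_, ?_⟩
  · simp [Measure.dirac_apply' _ hOm0.compl, hw0]
  · rw [Measure.dirac_apply' _ (measurableSet_Icc.prod hOm).compl]
    exact indicator_of_notMem (not_not_intro ⟨htp, hwOm tp hend⟩) _
  · rw [← mem_ae_iff]
    refine (ae_map_iff hae (measurableSet_Icc.prod hOm)).2 ?_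
    filter_upwards [ae_restrict_mem measurableSet_Icc] with t ht
    exact ⟨⟨ht.1, ht.2.trans htp.2⟩, hwOm t ht⟩
  · rw [Measure.dirac_prod_dirac, Measure.dirac_apply' _ (hS.prod hOm).compl]
    exact indicator_of_notMem (not_not_intro ⟨hs, hwOm tp hend⟩) _
  · rw [Measure.dirac_prod_dirac, Measure.dirac_apply' _ (hX.prod hXu).compl]
    exact indicator_of_notMem (not_not_intro ⟨hmaps s hs _ (hwOm tp hend), hy⟩) _
  · simp [Measure.dirac_apply' _ hOm0, hw0]
  · intro v hv
    rw [integral_lieD_occupation htp.1 hf hw hv, integral_dirac, integral_dirac]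
    ring
  · intro z _
    rw [Measure.dirac_prod_dirac, integral_dirac, integral_dirac]
  · intro z _
    rw [Measure.dirac_prod_dirac, Measure.dirac_prod_dirac, integral_dirac, integral_dirac]

/-- Every measure of a shape-feasible tuple other than `μ` has total mass one. -/
theorem ShapeFeasible.isProbabilityMeasure {nw ns n : ℕ} {T : ℝ}
    {Om Om0 : Set (Vec nw)} {S : Set (Vec ns)} {X Xu : Set (Vec n)}
    {A : Vec ns × Vec nw → Vec n} {f : ℝ × Vec nw → Vec nw}
    {μ0 : Measure (Vec nw)} {μp μ : Measure (ℝ × Vec nw)}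
    {μs : Measure (Vec ns × Vec nw)} {η : Measure (Vec n × Vec n)}
    (h : ShapeFeasible T Om Om0 S X Xu A f μ0 μp μ μs η) :
    IsProbabilityMeasure μ0 ∧ IsProbabilityMeasure μp ∧ IsProbabilityMeasure μs ∧
      IsProbabilityMeasure η := by
  obtain ⟨_, _, _, _, _, h0c, _, _, _, _, h0, hL, hps, hη⟩ := h
  have m0 : μ0 univ = 1 := by rw [← measure_eq_measure_of_null_sdiff (subset_univ Om0)
    (by rwa [← compl_eq_univ_sdiff]), h0]
  have r0 : μ0.real univ = 1 := by simp [measureReal_def, m0]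
  have hp := hL (fun _ => 1) contDiff_const
  have hs := hps (fun _ => 1) continuous_const
  have he := hη (fun _ => 1) continuous_const
  simp only [LieD, fderiv_fun_const, Pi.zero_apply, _root_.zero_apply,
    integral_zero, integral_const, smul_eq_mul, mul_one, add_zero] at hp hs he
  rw [r0] at hp
  rw [hp] at hs
  rw [← hs] at he
  exact ⟨⟨m0⟩, isProbabilityMeasure_iff_real.2 hp, isProbabilityMeasure_iff_real.2 hs.symm,
    isProbabilityMeasure_iff_real.2 he⟩

/-- If a probability measure vanishes off `s`, then `s` is nonempty. -/
theorem nonempty_of_measure_compl_eq_zero {α : Type*} [MeasurableSpace α] {μ : Measure α}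
    [IsProbabilityMeasure μ] {s : Set α} (h : μ sᶜ = 0) : s.Nonempty := by
  by_contra hs
  rw [not_nonempty_iff_eq_empty] at hs
  simp [hs] at h

/-- Staying at the initial time is admissible. -/
theorem exists_shapeAdmissible {nw : ℕ} {T : ℝ} (hT : 0 ≤ T) {Om Om0 : Set (Vec nw)}
    (hsub : Om0 ⊆ Om) (f : ℝ × Vec nw → Vec nw) {x : Vec nw} (hx : x ∈ Om0) :
    ∃ w, ShapeAdmissible T Om Om0 f w 0 := by
  refine ⟨fun t => x + t • f (0, x), left_mem_Icc.2 hT, by simpa using hx, ?_, ?_⟩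
  · intro t ht
    obtain rfl : t = 0 := by simpa using ht
    simpa using ((hasDerivAt_id (0 : ℝ)).smul_const (f (0, x))).const_add x
  · intro t ht
    obtain rfl : t = 0 := by simpa using ht
    simpa using hsub hx

/-- **Theorem 4**: shape measure-program lower bound.  Every shape
trajectory tuple `(y, s, ω₀, t_p)` yields a shape-feasible measure tuple (Diracs plus
the occupation measure) with objective value `c(A(s; ω_p), y)`, and consequently the
shape measure-program value `p*` lower bounds the shape trajectory value `P*`. -/
theorem shape_measure_program_lower_bound {nw ns n : ℕ} (T : ℝ) (hT : 0 < T)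
    (Om Om0 : Set (Vec nw)) (S : Set (Vec ns)) (X Xu : Set (Vec n))
    (hOm : IsCompact Om) (hOm0 : IsCompact Om0) (hS : IsCompact S)
    (hX : IsCompact X) (hXu : IsCompact Xu) (hOm0Om : Om0 ⊆ Om) (hXuX : Xu ⊆ X)
    (A : Vec ns × Vec nw → Vec n) (hA : Continuous A)
    (hmaps : ∀ s ∈ S, ∀ w ∈ Om, A (s, w) ∈ X)
    (f : ℝ × Vec nw → Vec nw) (K : NNReal) (hf : LipschitzWith K f)
    (c : Vec n × Vec n → ℝ) (hc : ContinuousOn c (X ×ˢ Xu)) :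
    (∀ (w : ℝ → Vec nw) (tp : ℝ) (s : Vec ns) (y : Vec n),
      ShapeAdmissible T Om Om0 f w tp → s ∈ S → y ∈ Xu →
      ShapeFeasible T Om Om0 S X Xu A f (Measure.dirac (w 0))
        (Measure.dirac (tp, w tp))
        (Measure.map (fun t => (t, w t)) (volume.restrict (Icc 0 tp)))
        ((Measure.dirac s).prod (Measure.dirac (w tp)))
        ((Measure.dirac (A (s, w tp))).prod (Measure.dirac y)) ∧
      (∫ p, c p ∂((Measure.dirac (A (s, w tp))).prod (Measure.dirac y))) =
        c (A (s, w tp), y)) ∧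
    sInf {r | ∃ μ0 μp μ μs η, ShapeFeasible T Om Om0 S X Xu A f μ0 μp μ μs η ∧
        r = ∫ p, c p ∂η} ≤
      sInf {r | ∃ (w : ℝ → Vec nw) (tp : ℝ) (s : Vec ns) (y : Vec n),
        ShapeAdmissible T Om Om0 f w tp ∧ s ∈ S ∧ y ∈ Xu ∧
        r = c (A (s, w tp), y)} := by
  have hfeas : ∀ (w : ℝ → Vec nw) (tp : ℝ) (s : Vec ns) (y : Vec n),
      ShapeAdmissible T Om Om0 f w tp → s ∈ S → y ∈ Xu → _ := fun w tp s y h hs hy =>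
    shapeFeasible_of_shapeAdmissible hOm.measurableSet hOm0.measurableSet hS.measurableSet
      hX.measurableSet hXu.measurableSet hmaps hf.continuous h hs hy
  have hobj : ∀ (w : ℝ → Vec nw) (tp : ℝ) (s : Vec ns) (y : Vec n),
      (∫ p, c p ∂((Measure.dirac (A (s, w tp))).prod (Measure.dirac y))) =
        c (A (s, w tp), y) := fun w tp s y => by
    rw [Measure.dirac_prod_dirac, integral_dirac]
  refine ⟨fun w tp s y h hs hy => ⟨hfeas w tp s y h hs hy, hobj w tp s y⟩, ?_⟩
  obtain ⟨C, hC⟩ := (hX.prod hXu).exists_bound_of_continuousOn hc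
  by_cases hne : ∃ μ0 μp μ μs η, ShapeFeasible T Om Om0 S X Xu A f μ0 μp μ μs η
  · obtain ⟨μ0, μp, μ, μs, η, h⟩ := hne
    obtain ⟨_, _, _, _⟩ := h.isProbabilityMeasure
    obtain ⟨-, -, -, -, -, h0, -, -, hs, hη, -⟩ := h
    obtain ⟨x, hx⟩ := nonempty_of_measure_compl_eq_zero h0
    obtain ⟨q, hq⟩ := nonempty_of_measure_compl_eq_zero hs
    obtain ⟨p, hp⟩ := nonempty_of_measure_compl_eq_zero hη
    obtain ⟨w, hw⟩ := exists_shapeAdmissible hT.le hOm0Om f hx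
    refine csInf_le_csInf ⟨-C, ?_⟩ ⟨_, w, 0, q.1, p.2, hw, hq.1, hp.2, rfl⟩ ?_
    · rintro r ⟨ν0, νp, ν, νs, ξ, hν, rfl⟩
      obtain ⟨-, -, -, _⟩ := hν.isProbabilityMeasure
      obtain ⟨-, -, -, -, -, -, -, -, -, hξ, -⟩ := hν
      have hbound := norm_integral_le_of_norm_le_const (μ := ξ) (f := c) (C := C)
        (Filter.mem_of_superset (mem_ae_iff.2 hξ) hC)
      rw [probReal_univ, mul_one, Real.norm_eq_abs] at hbound
      exact (abs_le.1 hbound).1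
    · rintro r ⟨w, tp, s, y, h, hs, hy, rfl⟩
      exact ⟨_, _, _, _, _, hfeas w tp s y h hs hy, (hobj w tp s y).symm⟩
  · refine le_of_eq (congrArg sInf (Set.ext fun r => ⟨?_, ?_⟩))
    · rintro ⟨μ0, μp, μ, μs, η, h, -⟩
      exact (hne ⟨μ0, μp, μ, μs, η, h⟩).elim
    · rintro ⟨w, tp, s, y, h, hs, hy, -⟩
      exact (hne ⟨_, _, _, _, _, hfeas w tp s y h hs hy⟩).elim
end
end

section
/- Bounded mass of shape-feasible measures (Lemma 2): Fix T > 0 and compact sets Ω ⊆ ℝ^{N_ω}, Ω₀ ⊆ Ω, S ⊆ ℝ^{N_s}, X ⊆ ℝⁿ, X_u ⊆ X, and a continuous map A : S × Ω → X. Every shape-feasible measure tuple (μ₀, μ_p, μ, μ_s, η) satisfies 1 = μ₀(Ω₀) = μ_p([0,T] × Ω) = μ_s(S × Ω) = η(X × X_u), and μ([0,T] × Ω) ≤ T. -/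
open MeasureTheory Set

noncomputable section

/-- A finite measure integrating the constant function `1` to `1` has full mass `1` on every set
with null complement. -/
lemma measure_eq_one_of_integral_one {α : Type*} [MeasurableSpace α] {ν : Measure α}
    {s : Set α} (hs : ν sᶜ = 0) (h : ∫ _, (1 : ℝ) ∂ν = 1) : ν s = 1 := by
  rw [measure_of_measure_compl_eq_zero hs]
  have h' : ν.real univ = 1 := by simpa using h
  exact (ENNReal.toReal_eq_one_iff _).1 h'

lemma LieD_const {m : ℕ} (f : ℝ × Vec m → Vec m) (c : ℝ) (p : ℝ × Vec m) :
    LieD f (fun _ => c) p = 0 := by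
  simp [LieD]

lemma LieD_fst {m : ℕ} (f : ℝ × Vec m → Vec m) (p : ℝ × Vec m) :
    LieD f Prod.fst p = 1 := by
  simp [LieD, fderiv_fst]

/-- **Lemma 2**: bounded mass of shape-feasible measures.  Every
shape-feasible tuple consists of probability measures `μ₀, μ_p, μ_s, η` on their
respective supports, and the occupation measure `μ` has mass at most `T`. -/
theorem shape_feasible_bounded_mass {nw ns n : ℕ} (T : ℝ) (hT : 0 < T)
    (Om Om0 : Set (Vec nw)) (S : Set (Vec ns)) (X Xu : Set (Vec n))
    (hOm : IsCompact Om) (hOm0 : IsCompact Om0) (hS : IsCompact S)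
    (hX : IsCompact X) (hXu : IsCompact Xu) (hOm0Om : Om0 ⊆ Om) (hXuX : Xu ⊆ X)
    (A : Vec ns × Vec nw → Vec n) (hA : Continuous A)
    (f : ℝ × Vec nw → Vec nw)
    (μ0 : Measure (Vec nw)) (μp μ : Measure (ℝ × Vec nw))
    (μs : Measure (Vec ns × Vec nw)) (η : Measure (Vec n × Vec n))
    (hF : ShapeFeasible T Om Om0 S X Xu A f μ0 μp μ μs η) :
    μ0 Om0 = 1 ∧ μp (Icc 0 T ×ˢ Om) = 1 ∧ μs (S ×ˢ Om) = 1 ∧ η (X ×ˢ Xu) = 1 ∧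
    μ (Icc 0 T ×ˢ Om) ≤ ENNReal.ofReal T := by
  obtain ⟨_, _, _, _, _, h0, hp, hm, hs, he, h01, hL, hz, hw⟩ := hF
  have i0 : ∫ _, (1 : ℝ) ∂μ0 = 1 := by
    simp [measureReal_def, ← measure_of_measure_compl_eq_zero h0, h01]
  have ip : ∫ _, (1 : ℝ) ∂μp = 1 := by
    have h := hL (fun _ => 1) contDiff_const
    simp only [LieD_const, integral_zero, add_zero] at h
    exact h.trans i0
  have is : ∫ _, (1 : ℝ) ∂μs = 1 := (hz (fun _ => 1) continuous_const).symm.trans ip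
  have ie : ∫ _, (1 : ℝ) ∂η = 1 := (hw (fun _ => 1) continuous_const).trans is
  refine ⟨h01, measure_eq_one_of_integral_one hp ip, measure_eq_one_of_integral_one hs is,
    measure_eq_one_of_integral_one he ie, ?_⟩
  have hμ : ∫ z, z.1 ∂μp = μ.real univ := by
    have h := hL Prod.fst contDiff_fst
    simpa [LieD_fst] using h
  have hmem : ∀ᵐ z ∂μp, z ∈ Icc 0 T ×ˢ Om := mem_ae_iff.2 hp
  have hle : ∫ z, z.1 ∂μp ≤ ∫ _, T ∂μp := by
    refine integral_mono_of_nonneg ?_ (integrable_const T) ?_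
    · filter_upwards [hmem] with z hz using hz.1.1
    · filter_upwards [hmem] with z hz using hz.1.2
  have hT' : ∫ _, T ∂μp = T := by
    have h' : μp.real univ = 1 := by simpa using ip
    simp [h']
  rw [hμ, hT'] at hle
  calc μ (Icc 0 T ×ˢ Om) ≤ μ univ := measure_mono (subset_univ _)
    _ = ENNReal.ofReal (μ.real univ) := (ofReal_measureReal).symm
    _ ≤ ENNReal.ofReal T := ENNReal.ofReal_le_ofReal hle
end
end
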